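/- For every slot k ∈ S∖{2n−2} and every (t,j) ∈ A, the lifted inequality x_{1,j,t} + x_{k,j,t} + Σ_{i ∈ V∖{t}} x_{k,t,i} + x_{k+1,j,t} − 1 ≤ y_{t,t,j} is facet-defining for Ptt(n). -/

import Mathlib

open Finset

attribute [local instance] Classical.propDecidable

namespace TTP

/-- `(k,i,j)` is a valid match index: slot `k ∈ S = {1,…,2n-2}`, home venue `i` and
away team `j` are distinct elements of `V = {1,…,n}`. -/
def IsMatch (n : ℕ) (m : ℕ × ℕ × ℕ) : Prop :=
  1 ≤ m.1 ∧ m.1 ≤ 2 * n - 2 ∧ 1 ≤ m.2.1 ∧ m.2.1 ≤ n ∧ 1 ≤ m.2.2 ∧ m.2.2 ≤ n ∧ m.2.1 ≠ m.2.2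

/-- `(t,i,j)` is a valid travel index: `t ∈ V` and `(i,j) ∈ A`. -/
def IsTravelIdx (n : ℕ) (p : ℕ × ℕ × ℕ) : Prop :=
  1 ≤ p.1 ∧ p.1 ≤ n ∧ 1 ≤ p.2.1 ∧ p.2.1 ≤ n ∧ 1 ≤ p.2.2 ∧ p.2.2 ≤ n ∧ p.2.1 ≠ p.2.2

/-- A (double round-robin) tournament: a set of matches such that in every slot every team
plays exactly once, and every ordered pair of distinct teams meets exactly once. -/
structure IsTournament (n : ℕ) (T : Set (ℕ × ℕ × ℕ)) : Prop where
  subset : ∀ m ∈ T, IsMatch n m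
  slot_team : ∀ k, 1 ≤ k → k ≤ 2 * n - 2 → ∀ t, 1 ≤ t → t ≤ n →
      ∃! m : ℕ × ℕ × ℕ, m ∈ T ∧ m.1 = k ∧ (t = m.2.1 ∨ t = m.2.2)
  pair : ∀ i j, 1 ≤ i → i ≤ n → 1 ≤ j → j ≤ n → i ≠ j → ∃! k : ℕ, (k, i, j) ∈ T

/-- The venue of team `t` in slot `k`: the home venue of the (unique) match of `t` in
slot `k`, and `t` itself if `t` has no match in slot `k` (in particular in the artificial
slots `0` and `2n-1`). -/
noncomputable def venue (T : Set (ℕ × ℕ × ℕ)) (t k : ℕ) : ℕ :=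
  if h : ∃ i, ∃ j, (k, i, j) ∈ T ∧ (t = i ∨ t = j) then h.choose else t

/-- The travel vector `ψ(T)`: `travel n T (t,i,j) = 1` iff for some `0 ≤ k ≤ 2n-2` team `t`
has venue `i` in slot `k` and venue `j` in slot `k+1`. -/
noncomputable def travel (n : ℕ) (T : Set (ℕ × ℕ × ℕ)) (p : ℕ × ℕ × ℕ) : ℝ :=
  if ∃ k, k ≤ 2 * n - 2 ∧ venue T p.1 k = p.2.1 ∧ venue T p.1 (k + 1) = p.2.2 then 1 else 0

/-- The play vector `χ(T)`: characteristic vector of `T`. -/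
noncomputable def play (T : Set (ℕ × ℕ × ℕ)) (m : ℕ × ℕ × ℕ) : ℝ :=
  if m ∈ T then 1 else 0

/-- The ambient space `ℝ^M × ℝ^{V×A}`. -/
abbrev Pt (n : ℕ) :=
  ({m : ℕ × ℕ × ℕ // IsMatch n m} → ℝ) × ({p : ℕ × ℕ × ℕ // IsTravelIdx n p} → ℝ)

/-- The play coordinate `x_{k,i,j}` of a point (0 at invalid indices). -/
noncomputable def xval {n : ℕ} (z : Pt n) (k i j : ℕ) : ℝ :=
  if h : IsMatch n (k, i, j) then z.1 ⟨(k, i, j), h⟩ else 0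

/-- The travel coordinate `y_{t,i,j}` of a point (0 at invalid indices). -/
noncomputable def yval {n : ℕ} (z : Pt n) (t i j : ℕ) : ℝ :=
  if h : IsTravelIdx n (t, i, j) then z.2 ⟨(t, i, j), h⟩ else 0

/-- The unconstrained traveling tournament polytope `Ptt(n)`:
the convex hull of all pairs `(χ(T), y)` with `T` a tournament and `y ∈ {0,1}^{V×A}`,
`y ≥ ψ(T)` componentwise. -/
def Ptt (n : ℕ) : Set (Pt n) :=
  convexHull ℝ { z : Pt n | ∃ T : Set (ℕ × ℕ × ℕ), IsTournament n T ∧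
    (∀ m : {m : ℕ × ℕ × ℕ // IsMatch n m}, z.1 m = play T m.1) ∧
    (∀ p : {p : ℕ × ℕ × ℕ // IsTravelIdx n p}, z.2 p = 0 ∨ z.2 p = 1) ∧
    (∀ p : {p : ℕ × ℕ × ℕ // IsTravelIdx n p}, travel n T p.1 ≤ z.2 p) }

/-- Dimension of the affine hull of a set. -/
noncomputable def adim {n : ℕ} (s : Set (Pt n)) : ℕ :=
  Module.finrank ℝ (affineSpan ℝ s).direction

/-- A valid inequality `f z ≤ γ` is facet-defining for `Ptt(n)`:
it holds on `Ptt(n)` and its face has dimension `dim Ptt(n) - 1`. -/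
def IsFacetLE {n : ℕ} (f : Pt n → ℝ) (γ : ℝ) : Prop :=
  (∀ z ∈ Ptt n, f z ≤ γ) ∧ adim {z ∈ Ptt n | f z = γ} + 1 = adim (Ptt n)

/-- A valid inequality `f z ≥ γ` is facet-defining for `Ptt(n)`:
it holds on `Ptt(n)` and its face has dimension `dim Ptt(n) - 1`. -/
def IsFacetGE {n : ℕ} (f : Pt n → ℝ) (γ : ℝ) : Prop :=
  (∀ z ∈ Ptt n, γ ≤ f z) ∧ adim {z ∈ Ptt n | f z = γ} + 1 = adim (Ptt n)

/-- The teams `1,…,n` as a finite type. -/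
abbrev Team (n : ℕ) := {i : ℕ // i ∈ Finset.Icc 1 n}

/-- `τ a b` is the slot of the match at venue `a` against `b`: all slots are valid and two
matches sharing a team take place in different slots. -/
structure IsSched (n : ℕ) (τ : Team n → Team n → ℕ) : Prop where
  mem : ∀ a b, a ≠ b → τ a b ∈ Finset.Icc 1 (2 * n - 2)
  home_inj : ∀ a b b', a ≠ b → a ≠ b' → τ a b = τ a b' → b = b'
  away_inj : ∀ a b b', a ≠ b → a ≠ b' → τ b a = τ b' a → b = b'
  home_ne_away : ∀ a b b', a ≠ b → a ≠ b' → τ a b ≠ τ b' a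

/-- The set of matches of a slot assignment. -/
def matchSet {n : ℕ} (τ : Team n → Team n → ℕ) : Set (ℕ × ℕ × ℕ) :=
  {m | ∃ a b : Team n, a ≠ b ∧ m = (τ a b, a.1, b.1)}

lemma card_team (n : ℕ) : Fintype.card (Team n) = n := by
  simp

lemma card_team_ne {n : ℕ} (a : Team n) : Fintype.card {b : Team n // b ≠ a} = n - 1 := by
  rw [Fintype.card_subtype_compl, Fintype.card_subtype_eq, card_team]

section Sched

variable {n : ℕ} {τ : Team n → Team n → ℕ}

lemma IsSched.bijective (h : IsSched n τ) (a : Team n) :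
    Function.Bijective (fun s : {b : Team n // b ≠ a} ⊕ {b : Team n // b ≠ a} =>
      (Sum.elim (fun b => ⟨τ a b.1, h.mem _ _ b.2.symm⟩)
        (fun b => ⟨τ b.1 a, h.mem _ _ b.2⟩) s : Finset.Icc 1 (2 * n - 2))) := by
  rw [Fintype.bijective_iff_injective_and_card]
  constructor
  · rintro (b | b) (b' | b') hb <;> simp only [Sum.elim_inl, Sum.elim_inr, Subtype.mk.injEq] at hb
    · exact congrArg _ (Subtype.ext (h.home_inj _ _ _ b.2.symm b'.2.symm hb))
    · exact absurd hb (h.home_ne_away _ _ _ b.2.symm b'.2.symm)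
    · exact absurd hb.symm (h.home_ne_away _ _ _ b'.2.symm b.2.symm)
    · exact congrArg _ (Subtype.ext (h.away_inj _ _ _ b.2.symm b'.2.symm hb))
  · rw [Fintype.card_sum, card_team_ne]
    simp
    omega

lemma IsSched.exists_opponent (h : IsSched n τ) (a : Team n) {r : ℕ}
    (hr : r ∈ Finset.Icc 1 (2 * n - 2)) : ∃ b, b ≠ a ∧ (τ a b = r ∨ τ b a = r) := by
  obtain ⟨b | b, hb⟩ := (h.bijective a).2 ⟨r, hr⟩
  · exact ⟨b.1, b.2, Or.inl (by simpa using congrArg Subtype.val hb)⟩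
  · exact ⟨b.1, b.2, Or.inr (by simpa using congrArg Subtype.val hb)⟩

lemma IsSched.sum_eq (h : IsSched n τ) (a : Team n) (φ : ℕ → ℝ) :
    ∑ b ∈ Finset.univ.filter (· ≠ a), (φ (τ a b) + φ (τ b a)) =
      ∑ p ∈ Finset.Icc 1 (2 * n - 2), φ p := by
  have h1 := (h.bijective a).sum_comp (fun p : Finset.Icc 1 (2 * n - 2) => φ p.1)
  rw [Fintype.sum_sum_type] at h1
  simp only [Sum.elim_inl, Sum.elim_inr] at h1
  rw [Finset.sum_coe_sort (Finset.Icc 1 (2 * n - 2)) φ] at h1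
  rw [← h1, ← Finset.sum_add_distrib]
  exact Finset.sum_subtype _ (by simp) _

lemma mem_matchSet {p : ℕ} {a b : Team n} :
    (p, a.1, b.1) ∈ matchSet τ ↔ a ≠ b ∧ τ a b = p := by
  constructor
  · rintro ⟨a', b', hne, he⟩
    simp only [Prod.mk.injEq] at he
    obtain ⟨h1, h2, h3⟩ := he
    obtain rfl := Subtype.ext h2
    obtain rfl := Subtype.ext h3
    exact ⟨hne, h1.symm⟩
  · rintro ⟨hne, rfl⟩
    exact ⟨a, b, hne, rfl⟩

lemma IsSched.isTournament (h : IsSched n τ) : IsTournament n (matchSet τ) where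
  subset := by
    rintro _ ⟨a, b, hne, rfl⟩
    have h1 := Finset.mem_Icc.1 (h.mem a b hne)
    have h2 := Finset.mem_Icc.1 a.2
    have h3 := Finset.mem_Icc.1 b.2
    exact ⟨h1.1, h1.2, h2.1, h2.2, h3.1, h3.2, fun e => hne (Subtype.ext e)⟩
  slot_team := by
    intro k hk1 hk2 t ht1 ht2
    obtain ⟨u, rfl⟩ : ∃ u : Team n, u.1 = t := ⟨⟨t, Finset.mem_Icc.2 ⟨ht1, ht2⟩⟩, rfl⟩
    obtain ⟨b, hb, hk⟩ := h.exists_opponent u (Finset.mem_Icc.2 ⟨hk1, hk2⟩)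
    have key : ∀ a' b' : Team n, a' ≠ b' → τ a' b' = k → (u = a' ∨ u = b') →
        (u = a' ∧ τ u b = k ∧ b' = b) ∨ (u = b' ∧ τ b u = k ∧ a' = b) := by
      rintro a' b' hne he (rfl | rfl)
      · rcases hk with hk | hk
        · exact Or.inl ⟨rfl, hk, h.home_inj _ _ _ hne hb.symm (he.trans hk.symm)⟩
        · exact absurd (he.trans hk.symm) (h.home_ne_away _ _ _ hne hb.symm)
      · rcases hk with hk | hk
        · exact absurd (hk.trans he.symm) (h.home_ne_away _ _ _ hb.symm hne.symm)
        · exact Or.inr ⟨rfl, hk, h.away_inj _ _ _ hne.symm hb.symm (he.trans hk.symm)⟩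
    rcases hk with hk | hk
    · refine ⟨(k, u.1, b.1), ⟨mem_matchSet.2 ⟨hb.symm, hk⟩, rfl, Or.inl rfl⟩, ?_⟩
      rintro _ ⟨⟨a', b', hne, rfl⟩, h2, h3⟩
      rcases key a' b' hne h2 (h3.imp Subtype.ext Subtype.ext) with ⟨rfl, -, rfl⟩ | ⟨-, h5, -⟩
      · simp only at h2
        rw [h2]
      · exact absurd (hk.trans h5.symm) (h.home_ne_away _ _ _ hb.symm hb.symm)
    · refine ⟨(k, b.1, u.1), ⟨mem_matchSet.2 ⟨hb, hk⟩, rfl, Or.inr rfl⟩, ?_⟩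
      rintro _ ⟨⟨a', b', hne, rfl⟩, h2, h3⟩
      rcases key a' b' hne h2 (h3.imp Subtype.ext Subtype.ext) with ⟨-, h5, -⟩ | ⟨rfl, -, rfl⟩
      · exact absurd (h5.trans hk.symm) (h.home_ne_away _ _ _ hb.symm hb.symm)
      · simp only at h2
        rw [h2]
  pair := by
    intro i j hi1 hi2 hj1 hj2 hij
    have hne : (⟨i, Finset.mem_Icc.2 ⟨hi1, hi2⟩⟩ : Team n) ≠ ⟨j, Finset.mem_Icc.2 ⟨hj1, hj2⟩⟩ :=
      fun e => hij (congrArg Subtype.val e)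
    refine ⟨_, mem_matchSet.2 ⟨hne, rfl⟩, fun k hk => ?_⟩
    exact (mem_matchSet (a := ⟨i, Finset.mem_Icc.2 ⟨hi1, hi2⟩⟩)
      (b := ⟨j, Finset.mem_Icc.2 ⟨hj1, hj2⟩⟩).1 hk).2.symm

lemma IsTournament.exists_sched {T : Set (ℕ × ℕ × ℕ)} (hT : IsTournament n T) :
    ∃ τ, IsSched n τ ∧ T = matchSet τ := by
  have hp : ∀ a b : Team n, ∃ k, a ≠ b → ((k, a.1, b.1) ∈ T ∧ ∀ k', (k', a.1, b.1) ∈ T → k' = k) := by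
    intro a b
    by_cases hne : a = b
    · exact ⟨0, fun h => absurd hne h⟩
    · have h2 := Finset.mem_Icc.1 a.2
      have h3 := Finset.mem_Icc.1 b.2
      obtain ⟨k, h1, h4⟩ := hT.pair a b h2.1 h2.2 h3.1 h3.2 (fun e => hne (Subtype.ext e))
      exact ⟨k, fun _ => ⟨h1, h4⟩⟩
  choose τ hτ using hp
  have hu : ∀ (u a b a' b' : Team n), a ≠ b → a' ≠ b' → τ a b = τ a' b' → (u = a ∨ u = b) →
      (u = a' ∨ u = b') → a = a' ∧ b = b' := by
    intro u a b a' b' h1 h2 he h3 h4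
    have hm := hT.subset _ (hτ a b h1).1
    have h2' := Finset.mem_Icc.1 u.2
    have := (hT.slot_team (τ a b) hm.1 hm.2.1 u h2'.1 h2'.2).unique
      ⟨(hτ a b h1).1, rfl, h3.imp (congrArg _) (congrArg _)⟩
      ⟨(hτ a' b' h2).1, he.symm, h4.imp (congrArg _) (congrArg _)⟩
    simp only [Prod.mk.injEq] at this
    exact ⟨Subtype.ext this.2.1, Subtype.ext this.2.2⟩
  refine ⟨τ, ⟨?_, ?_, ?_, ?_⟩, ?_⟩
  · intro a b h
    have hm := hT.subset _ (hτ a b h).1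
    exact Finset.mem_Icc.2 ⟨hm.1, hm.2.1⟩
  · intro a b b' h1 h2 he
    exact (hu a a b a b' h1 h2 he (Or.inl rfl) (Or.inl rfl)).2
  · intro a b b' h1 h2 he
    exact (hu a b a b' a h1.symm h2.symm he (Or.inr rfl) (Or.inr rfl)).1
  · intro a b b' h1 h2 he
    exact h2 (hu a a b b' a h1 h2.symm he (Or.inl rfl) (Or.inr rfl)).1
  · ext ⟨k, i, j⟩
    constructor
    · intro hm
      have h := hT.subset _ hm
      simp only [IsMatch] at h
      obtain ⟨a, rfl⟩ : ∃ u : Team n, u.1 = i := ⟨⟨i, Finset.mem_Icc.2 ⟨h.2.2.1, h.2.2.2.1⟩⟩, rfl⟩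
      obtain ⟨b, rfl⟩ : ∃ u : Team n, u.1 = j :=
        ⟨⟨j, Finset.mem_Icc.2 ⟨h.2.2.2.2.1, h.2.2.2.2.2.1⟩⟩, rfl⟩
      have hne : a ≠ b := fun e => h.2.2.2.2.2.2 (congrArg _ e)
      exact mem_matchSet.2 ⟨hne, ((hτ a b hne).2 _ hm).symm⟩
    · rintro ⟨a, b, hne, he⟩
      rw [he]
      exact (hτ a b hne).1

lemma venue_matchSet {u v : Team n} {p : ℕ} (hv : venue (matchSet τ) u p = v) (hne : v ≠ u) :
    τ v u = p := by
  unfold venue at hv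
  split_ifs at hv with h
  · obtain ⟨j, h1, h2⟩ := h.choose_spec
    rw [hv] at h1 h2
    rcases h2 with h2 | h2
    · exact absurd (Subtype.ext h2.symm) hne
    · rw [← h2] at h1
      exact (mem_matchSet.1 h1).2
  · exact absurd (Subtype.ext hv.symm) hne

lemma IsSched.venue_mem (h : IsSched n τ) (u a b : Team n) (hne : a ≠ b)
    (hu : u = a ∨ u = b) : venue (matchSet τ) u (τ a b) = a := by
  have hex : ∃ i, ∃ j, (τ a b, i, j) ∈ matchSet τ ∧ (u.1 = i ∨ u.1 = j) :=
    ⟨a, b, mem_matchSet.2 ⟨hne, rfl⟩, hu.imp (congrArg _) (congrArg _)⟩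
  unfold venue
  rw [dif_pos hex]
  obtain ⟨j, h1, h2⟩ := hex.choose_spec
  have hs := Finset.mem_Icc.1 (h.mem a b hne)
  have hu' := Finset.mem_Icc.1 u.2
  have := (h.isTournament.slot_team (τ a b) hs.1 hs.2 u hu'.1 hu'.2).unique
    ⟨h1, rfl, h2⟩ ⟨mem_matchSet.2 ⟨hne, rfl⟩, rfl, hu.imp (congrArg _) (congrArg _)⟩
  simp only [Prod.mk.injEq] at this
  exact this.2.1

lemma IsSched.venue_zero (h : IsSched n τ) (u : Team n) : venue (matchSet τ) u 0 = u := by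
  unfold venue
  rw [dif_neg]
  rintro ⟨i, j, h1, -⟩
  have := (h.isTournament.subset _ h1).1
  simp at this

end Sched

section Moves

variable {n : ℕ} {τ : Team n → Team n → ℕ}

/-- Exchange the home rights in the two matches between `a` and `b`. -/
noncomputable def flip (τ : Team n → Team n → ℕ) (a b u v : Team n) : ℕ :=
  if (u = a ∧ v = b) ∨ (u = b ∧ v = a) then τ v u else τ u v

lemma flip_left (τ : Team n → Team n → ℕ) (a b : Team n) : flip τ a b a b = τ b a := by
  simp [flip]

lemma flip_right (τ : Team n → Team n → ℕ) (a b : Team n) : flip τ a b b a = τ a b := by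
  simp [flip]

lemma flip_of_ne {a b u v : Team n} (h1 : ¬(u = a ∧ v = b)) (h2 : ¬(u = b ∧ v = a)) :
    flip τ a b u v = τ u v := by
  simp [flip, h1, h2]

lemma flip_eq_or (τ : Team n → Team n → ℕ) (a b u v : Team n) :
    (flip τ a b u v = τ u v ∧ flip τ a b v u = τ v u) ∨
      (flip τ a b u v = τ v u ∧ flip τ a b v u = τ u v) := by
  unfold flip
  by_cases h1 : u = a ∧ v = b
  · obtain ⟨rfl, rfl⟩ := h1
    simp
  · by_cases h2 : u = b ∧ v = a
    · obtain ⟨rfl, rfl⟩ := h2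
      simp
    · have h3 : ¬(v = a ∧ u = b) := fun h => h2 ⟨h.2, h.1⟩
      have h4 : ¬(v = b ∧ u = a) := fun h => h1 ⟨h.2, h.1⟩
      simp [h1, h2, h3, h4]

lemma IsSched.flip (h : IsSched n τ) (a b : Team n) : IsSched n (flip τ a b) where
  mem u v hne := by
    rcases flip_eq_or τ a b u v with ⟨h1, -⟩ | ⟨h1, -⟩ <;> rw [h1]
    · exact h.mem _ _ hne
    · exact h.mem _ _ hne.symm
  home_inj u v v' h1 h2 he := by
    rcases flip_eq_or τ a b u v with ⟨h3, -⟩ | ⟨h3, -⟩ <;>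
      rcases flip_eq_or τ a b u v' with ⟨h4, -⟩ | ⟨h4, -⟩ <;> rw [h3, h4] at he
    · exact h.home_inj _ _ _ h1 h2 he
    · exact absurd he (h.home_ne_away _ _ _ h1 h2)
    · exact absurd he.symm (h.home_ne_away _ _ _ h2 h1)
    · exact h.away_inj _ _ _ h1 h2 he
  away_inj u v v' h1 h2 he := by
    rcases flip_eq_or τ a b u v with ⟨-, h3⟩ | ⟨-, h3⟩ <;>
      rcases flip_eq_or τ a b u v' with ⟨-, h4⟩ | ⟨-, h4⟩ <;> rw [h3, h4] at he
    · exact h.away_inj _ _ _ h1 h2 he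
    · exact absurd he.symm (h.home_ne_away _ _ _ h2 h1)
    · exact absurd he (h.home_ne_away _ _ _ h1 h2)
    · exact h.home_inj _ _ _ h1 h2 he
  home_ne_away u v v' h1 h2 he := by
    by_cases hv : v = v'
    · subst hv
      rcases flip_eq_or τ a b u v with ⟨h3, h4⟩ | ⟨h3, h4⟩ <;> rw [h3, h4] at he
      · exact h.home_ne_away _ _ _ h1 h1 he
      · exact h.home_ne_away _ _ _ h1 h1 he.symm
    · rcases flip_eq_or τ a b u v with ⟨h3, -⟩ | ⟨h3, -⟩ <;>
        rcases flip_eq_or τ a b u v' with ⟨-, h4⟩ | ⟨-, h4⟩ <;> rw [h3, h4] at he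
      · exact h.home_ne_away _ _ _ h1 h2 he
      · exact hv (h.home_inj _ _ _ h1 h2 he)
      · exact hv (h.away_inj _ _ _ h1 h2 he)
      · exact h.home_ne_away _ _ _ h2 h1 he.symm

/-- Team `u` plays at home in slot `r`. -/
def HomeAt (τ : Team n → Team n → ℕ) (u : Team n) (r : ℕ) : Prop := ∃ v, u ≠ v ∧ τ u v = r

/-- Team `u` plays away in slot `r`. -/
def AwayAt (τ : Team n → Team n → ℕ) (u : Team n) (r : ℕ) : Prop := ∃ v, u ≠ v ∧ τ v u = r

lemma IsSched.not_homeAt (h : IsSched n τ) {u : Team n} {r : ℕ} (ha : AwayAt τ u r) :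
    ¬HomeAt τ u r := by
  rintro ⟨v, h1, h2⟩
  obtain ⟨w, h3, h4⟩ := ha
  exact h.home_ne_away _ _ _ h1 h3 (h2.trans h4.symm)

lemma IsSched.homeAt_or_awayAt (h : IsSched n τ) (u : Team n) {r : ℕ}
    (hr : r ∈ Finset.Icc 1 (2 * n - 2)) : HomeAt τ u r ∨ AwayAt τ u r := by
  obtain ⟨v, h1, h2 | h2⟩ := h.exists_opponent u hr
  · exact Or.inl ⟨v, h1.symm, h2⟩
  · exact Or.inr ⟨v, h1.symm, h2⟩

lemma flip_agree {a b : Team n} {r : ℕ} (hr : τ a b = r ∨ τ b a = r) (u v : Team n)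
    (h1 : τ u v ≠ r) (h2 : τ v u ≠ r) : flip τ a b u v = τ u v := by
  apply flip_of_ne
  · rintro ⟨rfl, rfl⟩
    exact hr.elim h1 h2
  · rintro ⟨rfl, rfl⟩
    exact hr.elim h2 h1

lemma IsSched.exists_awayAt (h : IsSched n τ) (u : Team n) {r : ℕ}
    (hr : r ∈ Finset.Icc 1 (2 * n - 2)) : ∃ τ', IsSched n τ' ∧ AwayAt τ' u r ∧
      ∀ a b, τ a b ≠ r → τ b a ≠ r → τ' a b = τ a b := by
  rcases h.homeAt_or_awayAt u hr with ⟨v, h1, h2⟩ | h1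
  · exact ⟨_, h.flip u v, ⟨v, h1, by rw [flip_right, h2]⟩, flip_agree (Or.inl h2)⟩
  · exact ⟨τ, h, h1, fun _ _ _ _ => rfl⟩

lemma IsSched.exists_homeAt (h : IsSched n τ) (u : Team n) {r : ℕ}
    (hr : r ∈ Finset.Icc 1 (2 * n - 2)) : ∃ τ', IsSched n τ' ∧ HomeAt τ' u r ∧
      ∀ a b, τ a b ≠ r → τ b a ≠ r → τ' a b = τ a b := by
  rcases h.homeAt_or_awayAt u hr with h1 | ⟨v, h1, h2⟩
  · exact ⟨τ, h, h1, fun _ _ _ _ => rfl⟩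
  · exact ⟨_, h.flip u v, ⟨v, h1, by rw [flip_left, h2]⟩, flip_agree (Or.inr h2)⟩

lemma IsSched.exists_homeAt_awayAt (h : IsSched n τ) (u : Team n) {r s : ℕ}
    (hr : r ∈ Finset.Icc 1 (2 * n - 2)) (hs : s ∈ Finset.Icc 1 (2 * n - 2)) (hrs : r ≠ s) :
    ∃ τ', IsSched n τ' ∧ HomeAt τ' u r ∧ AwayAt τ' u s ∧
      ∀ a b, τ a b ≠ r → τ b a ≠ r → τ a b ≠ s → τ b a ≠ s → τ' a b = τ a b := by
  obtain ⟨τ₁, h1, ⟨v, hv, hv'⟩, h3⟩ := h.exists_homeAt u hr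
  by_cases hvs : τ₁ v u = s
  · exact ⟨τ₁, h1, ⟨v, hv, hv'⟩, ⟨v, hv, hvs⟩, fun a b e1 e2 _ _ => h3 a b e1 e2⟩
  · obtain ⟨τ₂, h4, h5, h6⟩ := h1.exists_awayAt u hs
    refine ⟨τ₂, h4, ⟨v, hv, ?_⟩, h5, fun a b e1 e2 e3 e4 => ?_⟩
    · rw [h6 _ _ (by rw [hv']; exact hrs) hvs, hv']
    · have e5 := h3 a b e1 e2
      have e6 := h3 b a e2 e1
      rw [h6 _ _ (by rw [e5]; exact e3) (by rw [e6]; exact e4), e5]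

/-- The total weight of the matches of a slot assignment. -/
noncomputable def weight (c : ℕ → Team n → Team n → ℝ) (τ : Team n → Team n → ℕ) : ℝ :=
  ∑ p : Team n × Team n, c (τ p.1 p.2) p.1 p.2

lemma weight_flip (c : ℕ → Team n → Team n → ℝ) {a b : Team n} (hab : a ≠ b) :
    weight c (flip τ a b) - weight c τ =
      (c (τ b a) a b - c (τ b a) b a) - (c (τ a b) a b - c (τ a b) b a) := by
  unfold weight
  rw [← Finset.sum_sub_distrib, Fintype.sum_eq_add (a, b) (b, a)]
  · simp only [flip_left, flip_right]
    ring
  · simp [hab]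
  · rintro ⟨u, v⟩ ⟨h1, h2⟩
    rw [Ne, Prod.mk.injEq] at h1 h2
    simp [flip_of_ne h1 h2]

end Moves

section Colorings

variable {n : ℕ}

/-- A proper edge coloring of the complete graph on the teams with `n - 1` colors. -/
structure IsColoring (n : ℕ) (κ : Team n → Team n → Fin (n - 1)) : Prop where
  symm : ∀ a b, κ a b = κ b a
  inj : ∀ a b b', a ≠ b → a ≠ b' → κ a b = κ a b' → b = b'

lemma natCast_zmod_inj {N a b : ℕ} (ha : 1 ≤ a) (ha' : a ≤ N) (hb : 1 ≤ b) (hb' : b ≤ N)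
    (h : (a : ZMod N) = b) : a = b := by
  rw [ZMod.natCast_eq_natCast_iff] at h
  obtain ⟨d, hd⟩ := h.dvd
  have h1 : d < 1 := by
    by_contra hc
    push Not at hc
    nlinarith
  have h2 : -1 < d := by
    by_contra hc
    push Not at hc
    nlinarith
  have : d = 0 := by omega
  subst this
  omega

lemma exists_isColoring (hn : 4 ≤ n) (heven : Even n) : ∃ κ, IsColoring n κ := by
  have hN : NeZero (n - 1) := ⟨by omega⟩
  have hodd : Odd (n - 1) := Nat.Even.sub_odd (by omega) heven odd_one
  have htwo : ∀ x y : ZMod (n - 1), 2 * x = 2 * y → x = y := by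
    intro x y hxy
    have hu : IsUnit ((2 : ℕ) : ZMod (n - 1)) :=
      (ZMod.isUnit_iff_coprime 2 (n - 1)).2 hodd.coprime_two_left
    exact hu.mul_left_cancel (by exact_mod_cast hxy)
  let e : ZMod (n - 1) ≃ Fin (n - 1) := Fintype.equivFinOfCardEq (ZMod.card _)
  have hcast : ∀ a b : Team n, a.1 ≠ n → b.1 ≠ n → ((a.1 : ℕ) : ZMod (n - 1)) = (b.1 : ℕ) → a = b := by
    intro a b ha hb h
    have h1 := Finset.mem_Icc.1 a.2
    have h2 := Finset.mem_Icc.1 b.2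
    exact Subtype.ext (natCast_zmod_inj h1.1 (by omega) h2.1 (by omega) h)
  refine ⟨fun a b => e (if a.1 = n then 2 * (b.1 : ZMod (n - 1)) else
    if b.1 = n then 2 * (a.1 : ZMod (n - 1)) else (a.1 : ZMod (n - 1)) + b.1), ?_, ?_⟩
  · intro a b
    by_cases ha : a.1 = n <;> by_cases hb : b.1 = n <;> simp [ha, hb, add_comm]
  · intro a b b' h1 h2 he
    have he := e.injective he
    have hab : a.1 ≠ b.1 := fun h => h1 (Subtype.ext h)
    have hab' : a.1 ≠ b'.1 := fun h => h2 (Subtype.ext h)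
    by_cases ha : a.1 = n
    · simp only [ha, if_true] at he
      exact hcast _ _ (by omega) (by omega) (htwo _ _ he)
    · by_cases hb : b.1 = n <;> by_cases hb' : b'.1 = n
      · exact Subtype.ext (hb.trans hb'.symm)
      · simp only [ha, hb, hb', if_true, if_false, two_mul] at he
        exact absurd (hcast _ _ ha hb' (add_left_cancel he)) h2
      · simp only [ha, hb, hb', if_true, if_false, two_mul] at he
        exact absurd (hcast _ _ ha hb (add_left_cancel he.symm)) h1
      · simp only [ha, hb, hb', if_false] at he
        exact hcast _ _ hb hb' (add_left_cancel he)

lemma IsColoring.comp {κ : Team n → Team n → Fin (n - 1)} (h : IsColoring n κ)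
    (σ : Equiv.Perm (Team n)) : IsColoring n (fun a b => κ (σ a) (σ b)) where
  symm _ _ := h.symm _ _
  inj _ _ _ h1 h2 he :=
    σ.injective (h.inj _ _ _ (σ.injective.ne h1) (σ.injective.ne h2) he)

lemma IsColoring.exists_neighbor {κ : Team n → Team n → Fin (n - 1)} (h : IsColoring n κ)
    (a : Team n) (x : Fin (n - 1)) : ∃ b, b ≠ a ∧ κ a b = x := by
  have hb : Function.Bijective (fun b : {b : Team n // b ≠ a} => κ a b.1) := by
    rw [Fintype.bijective_iff_injective_and_card]
    refine ⟨fun b b' he => Subtype.ext (h.inj _ _ _ b.2.symm b'.2.symm he), ?_⟩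
    rw [card_team_ne, Fintype.card_fin]
  obtain ⟨b, hb⟩ := hb.2 x
  exact ⟨b.1, b.2, hb⟩

/-- The slot assignment obtained from a coloring `κ`, an assignment `g` of slots to the two
copies of each color, and an orientation `ε`. -/
def schedOf (κ : Team n → Team n → Fin (n - 1))
    (g : Fin (n - 1) × Bool ≃ Finset.Icc 1 (2 * n - 2)) (ε : Team n → Team n → Bool)
    (a b : Team n) : ℕ := g (κ a b, ε a b)

lemma IsColoring.isSched {κ : Team n → Team n → Fin (n - 1)} (h : IsColoring n κ)
    (g : Fin (n - 1) × Bool ≃ Finset.Icc 1 (2 * n - 2)) {ε : Team n → Team n → Bool}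
    (hε : ∀ a b, a ≠ b → ε b a = !ε a b) : IsSched n (schedOf κ g ε) where
  mem _ _ _ := (g _).2
  home_inj _ _ _ h1 h2 he :=
    h.inj _ _ _ h1 h2 (congrArg Prod.fst (g.injective (Subtype.ext he)))
  away_inj a b b' h1 h2 he := by
    have := congrArg Prod.fst (g.injective (Subtype.ext he))
    exact h.inj _ _ _ h1 h2 (by rw [h.symm a b, h.symm a b']; exact this)
  home_ne_away a b b' h1 h2 he := by
    have he := g.injective (Subtype.ext he)
    have h3 := h.inj _ _ _ h1 h2 ((congrArg Prod.fst he).trans (h.symm _ _))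
    subst h3
    have h4 := congrArg Prod.snd he
    simp only [hε a b h1] at h4
    cases hq : ε a b <;> simp [hq] at h4

lemma exists_equiv_of_injective {ι α β : Type*} [Fintype α] [Fintype β] [Fintype ι]
    (hc : Fintype.card α = Fintype.card β) {u : ι → α} {w : ι → β}
    (hu : Function.Injective u) (hw : Function.Injective w) :
    ∃ g : α ≃ β, ∀ i, g (u i) = w i := by
  let e := (Equiv.ofInjective u hu).symm.trans (Equiv.ofInjective w hw)
  have hcard : Fintype.card ((Set.range u)ᶜ : Set α) = Fintype.card ((Set.range w)ᶜ : Set β) := by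
    rw [Fintype.card_compl_set, Fintype.card_compl_set, hc, Fintype.card_congr e]
  refine ⟨(Equiv.Set.sumCompl (Set.range u)).symm.trans
    ((Equiv.sumCongr e (Fintype.equivOfCardEq hcard)).trans (Equiv.Set.sumCompl (Set.range w))),
    fun i => ?_⟩
  have h1 : (Equiv.Set.sumCompl (Set.range u)).symm (u i) = Sum.inl ⟨u i, i, rfl⟩ :=
    Equiv.Set.sumCompl_symm_apply_of_mem (Set.mem_range_self i)
  have h2 : (Equiv.ofInjective u hu).symm ⟨u i, i, rfl⟩ = i := Equiv.ofInjective_symm_apply hu i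
  simp [h1, h2, e]

lemma card_color_bool (n : ℕ) :
    Fintype.card (Fin (n - 1) × Bool) = Fintype.card (Finset.Icc 1 (2 * n - 2)) := by
  simp
  omega

end Colorings

section Arrangements

variable {n : ℕ}

lemma exists_orientation {a b a' b' : Team n} (h : ¬(a' = b ∧ b' = a)) : ∃ ε : Team n → Team n → Bool,
      (∀ u v, u ≠ v → ε v u = !ε u v) ∧ ε a b = true ∧ ε a' b' = true := by
  refine ⟨fun u v => decide ((u = a ∧ v = b) ∨ (u = a' ∧ v = b') ∨
    (¬((v = a ∧ u = b) ∨ (v = a' ∧ u = b')) ∧ u < v)), ?_, by simp, by simp⟩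
  intro u v huv
  have h1 : u < v ↔ ¬ v < u := by
    constructor
    · exact fun h => h.asymm
    · exact fun h => lt_of_le_of_ne (not_lt.1 h) huv
  simp only [← decide_not, decide_eq_decide]
  grind

lemma exists_sched_pair (hn : 4 ≤ n) (heven : Even n) {a b : Team n} (hab : a ≠ b) {p q : ℕ}
    (hp : p ∈ Finset.Icc 1 (2 * n - 2)) (hq : q ∈ Finset.Icc 1 (2 * n - 2)) (hpq : p ≠ q) :
    ∃ τ, IsSched n τ ∧ τ a b = p ∧ τ b a = q := by
  obtain ⟨κ, hκ⟩ := exists_isColoring hn heven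
  obtain ⟨ε, hε, h1, -⟩ := exists_orientation (a := a) (b := b) (a' := a) (b' := b) (fun h => hab h.1)
  obtain ⟨g, hg⟩ := exists_equiv_of_injective (card_color_bool n)
    (u := ![(κ a b, true), (κ a b, false)])
    (w := ![(⟨p, hp⟩ : Finset.Icc 1 (2 * n - 2)), ⟨q, hq⟩])
    (by simp [Function.Injective, Fin.forall_fin_succ])
    (by simp [Function.Injective, Fin.forall_fin_succ, hpq, hpq.symm])
  simp only [Fin.forall_fin_succ, Matrix.cons_val_zero, Matrix.cons_val_succ] at hg
  refine ⟨schedOf κ g ε, hκ.isSched g hε, ?_, ?_⟩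
  · rw [schedOf, h1, hg.1]
  · rw [schedOf, hε a b hab, h1, hκ.symm b a, Bool.not_true, hg.2.1]

lemma exists_sched_adjacent (hn : 4 ≤ n) (heven : Even n) {u v w : Team n} (huv : u ≠ v)
    (huw : u ≠ w) (hvw : v ≠ w) {p q p' q' : ℕ}
    (hp : p ∈ Finset.Icc 1 (2 * n - 2)) (hq : q ∈ Finset.Icc 1 (2 * n - 2))
    (hp' : p' ∈ Finset.Icc 1 (2 * n - 2)) (hq' : q' ∈ Finset.Icc 1 (2 * n - 2))
    (h1 : p ≠ q) (h2 : p ≠ p') (h3 : p ≠ q') (h4 : q ≠ p') (h5 : q ≠ q') (h6 : p' ≠ q') :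
    ∃ τ, IsSched n τ ∧ τ u v = p ∧ τ v u = q ∧ τ u w = p' ∧ τ w u = q' := by
  obtain ⟨κ, hκ⟩ := exists_isColoring hn heven
  have hc : κ u v ≠ κ u w := fun h => hvw (hκ.inj _ _ _ huv huw h)
  obtain ⟨ε, hε, e1, e2⟩ := exists_orientation (a := u) (b := v) (a' := u) (b' := w) (fun h => huv h.1)
  obtain ⟨g, hg⟩ := exists_equiv_of_injective (card_color_bool n)
    (u := ![(κ u v, true), (κ u v, false), (κ u w, true), (κ u w, false)])
    (w := ![(⟨p, hp⟩ : Finset.Icc 1 (2 * n - 2)), ⟨q, hq⟩, ⟨p', hp'⟩, ⟨q', hq'⟩])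
    (by simp [Function.Injective, Fin.forall_fin_succ, hc, hc.symm])
    (by simp [Function.Injective, Fin.forall_fin_succ, h1, h2, h3, h4, h5, h6, h1.symm, h2.symm,
          h3.symm, h4.symm, h5.symm, h6.symm])
  simp only [Fin.forall_fin_succ, Matrix.cons_val_zero, Matrix.cons_val_succ] at hg
  refine ⟨schedOf κ g ε, hκ.isSched g hε, ?_, ?_, ?_, ?_⟩
  · rw [schedOf, e1, hg.1]
  · rw [schedOf, hε u v huv, e1, hκ.symm v u, Bool.not_true, hg.2.1]
  · rw [schedOf, e2, hg.2.2.1]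
  · rw [schedOf, hε u w huw, e2, hκ.symm w u, Bool.not_true, hg.2.2.2.1]

lemma exists_sched_disjoint (hn : 4 ≤ n) (heven : Even n) {a b a' b' : Team n} (hab : a ≠ b)
    (haa : a ≠ a') (hab' : a ≠ b') (hba : b ≠ a') (hbb : b ≠ b') (hab'' : a' ≠ b') {p q : ℕ}
    (hp : p ∈ Finset.Icc 1 (2 * n - 2)) (hq : q ∈ Finset.Icc 1 (2 * n - 2)) (hpq : p ≠ q) :
    ∃ τ, IsSched n τ ∧ τ a b = p ∧ τ b a = q ∧ τ a' b' = p ∧ τ b' a' = q := by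
  obtain ⟨κ₀, hκ₀⟩ := exists_isColoring hn heven
  obtain ⟨d, hd1, hd2⟩ := hκ₀.exists_neighbor a' (κ₀ a b)
  have hda : d ≠ a := by
    rintro rfl
    exact hba (hκ₀.inj d b a' hab haa ((hd2.symm.trans (hκ₀.symm _ _))))
  have hdb : d ≠ b := by
    rintro rfl
    exact haa (hκ₀.inj d a a' hab.symm hba ((hκ₀.symm _ _).trans (hd2.symm.trans (hκ₀.symm _ _))))
  let σ : Equiv.Perm (Team n) := Equiv.swap d b'
  have hκ := hκ₀.comp σ
  have s1 : σ a = a := Equiv.swap_apply_of_ne_of_ne hda.symm hab'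
  have s2 : σ b = b := Equiv.swap_apply_of_ne_of_ne hdb.symm hbb
  have s3 : σ a' = a' := Equiv.swap_apply_of_ne_of_ne hd1.symm hab''
  have s4 : σ b' = d := Equiv.swap_apply_right _ _
  generalize hκ' : (fun u v => κ₀ (σ u) (σ v)) = κ at hκ
  have hc : κ a' b' = κ a b := by
    rw [← hκ']
    simp only [s1, s2, s3, s4, hd2]
  obtain ⟨ε, hε, e1, e2⟩ := exists_orientation (a := a) (b := b) (a' := a') (b' := b') (fun h => hba h.1.symm)
  obtain ⟨g, hg⟩ := exists_equiv_of_injective (card_color_bool n)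
    (u := ![(κ a b, true), (κ a b, false)])
    (w := ![(⟨p, hp⟩ : Finset.Icc 1 (2 * n - 2)), ⟨q, hq⟩])
    (by simp [Function.Injective, Fin.forall_fin_succ])
    (by simp [Function.Injective, Fin.forall_fin_succ, hpq, hpq.symm])
  simp only [Fin.forall_fin_succ, Matrix.cons_val_zero, Matrix.cons_val_succ] at hg
  refine ⟨schedOf κ g ε, hκ.isSched g hε, ?_, ?_, ?_, ?_⟩
  · rw [schedOf, e1, hg.1]
  · rw [schedOf, hε a b hab, e1, hκ.symm b a, Bool.not_true, hg.2.1]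
  · rw [schedOf, e2, hc, hg.1]
  · rw [schedOf, hε a' b' hab'', e2, hκ.symm b' a', Bool.not_true, hc, hg.2.1]

end Arrangements

section Matchings

lemma sum_matching_sub_swap {V : Type*} [Fintype V] {m : V → V} (hm : ∀ a, m (m a) = a)
    (hm' : ∀ a, m a ≠ a) {δ : V → V → ℝ} (hδ : ∀ a b, δ a b = δ b a) {a c : V} (hac : a ≠ c)
    (hmac : m a ≠ c) :
    ∑ u, δ u (m u) - ∑ u, δ (Equiv.swap a c u) (Equiv.swap a c (m u)) =
      2 * (δ a (m a) - δ c (m a) + δ c (m c) - δ a (m c)) := by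
  have h1 : m c ≠ a := fun h => hmac (by rw [← h, hm])
  have h2 : m a ≠ m c := fun h => hac (by rw [← hm a, h, hm])
  rw [← Finset.sum_sub_distrib, ← Finset.sum_subset (Finset.subset_univ {a, m a, c, m c})]
  · rw [Finset.sum_insert (by simp [hac, (hm' a).symm, h1.symm]),
      Finset.sum_insert (by simp [hmac, h2]), Finset.sum_insert (by simp [(hm' c).symm]),
      Finset.sum_singleton]
    simp only [hm, Equiv.swap_apply_left, Equiv.swap_apply_right,
      Equiv.swap_apply_of_ne_of_ne (hm' a) hmac, Equiv.swap_apply_of_ne_of_ne h1 (hm' c)]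
    rw [hδ (m a) a, hδ (m c) c, hδ (m a) c, hδ (m c) a]
    ring
  · intro u _ hu
    simp only [Finset.mem_insert, Finset.mem_singleton, not_or] at hu
    have h3 : m u ≠ a := fun h => hu.2.1 (by rw [← h, hm])
    have h4 : m u ≠ c := fun h => hu.2.2.2 (by rw [← h, hm])
    rw [Equiv.swap_apply_of_ne_of_ne hu.1 hu.2.2.1, Equiv.swap_apply_of_ne_of_ne h3 h4, sub_self]

/-- If `δ` has the same sum over all simultaneous relabelings of two disjoint perfect matchings,
then its alternating sum over each 4-cycle vanishes. -/
lemma alternating_of_matchings {V : Type*} [Fintype V] [Nonempty V] {m m' : V → V}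
    (hm : ∀ a, m (m a) = a) (hm1 : ∀ a, m a ≠ a) (hm' : ∀ a, m' (m' a) = a)
    (hm1' : ∀ a, m' a ≠ a) (hne : ∀ a, m a ≠ m' a) {δ : V → V → ℝ} (hδ : ∀ a b, δ a b = δ b a)
    (h : ∀ σ : Equiv.Perm V, ∑ a, δ (σ a) (σ (m a)) = ∑ a, δ (σ a) (σ (m' a)))
    {a b c d : V} (hab : a ≠ b) (hac : a ≠ c) (had : a ≠ d) (hbc : b ≠ c) (hbd : b ≠ d)
    (hcd : c ≠ d) : δ a b + δ c d = δ b c + δ a d := by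
  obtain ⟨b₀⟩ := ‹Nonempty V›
  obtain ⟨a₀, ha₀⟩ : ∃ a₀, m b₀ = a₀ := ⟨_, rfl⟩
  obtain ⟨c₀, hc₀⟩ : ∃ c₀, m' b₀ = c₀ := ⟨_, rfl⟩
  obtain ⟨d₀, hd₀⟩ : ∃ d₀, m c₀ = d₀ := ⟨_, rfl⟩
  obtain ⟨x₀, hx₀⟩ : ∃ x₀, m' a₀ = x₀ := ⟨_, rfl⟩
  have e1 : m a₀ = b₀ := by rw [← ha₀, hm]
  have e2 : m' c₀ = b₀ := by rw [← hc₀, hm']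
  have n1 : a₀ ≠ b₀ := ha₀ ▸ hm1 b₀
  have n2 : c₀ ≠ b₀ := hc₀ ▸ hm1' b₀
  have n3 : a₀ ≠ c₀ := by rw [← ha₀, ← hc₀]; exact hne b₀
  have n4 : d₀ ≠ c₀ := hd₀ ▸ hm1 c₀
  have n5 : d₀ ≠ a₀ := by
    intro e
    rw [e, ← ha₀] at hd₀
    exact n2 (by rw [← hm c₀, hd₀, hm])
  have n6 : d₀ ≠ b₀ := by
    intro e
    rw [e] at hd₀
    exact hne c₀ (hd₀.trans e2.symm)
  have n7 : x₀ ≠ a₀ := hx₀ ▸ hm1' a₀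
  have n8 : x₀ ≠ b₀ := by
    intro e
    rw [e] at hx₀
    exact hne a₀ (e1.trans hx₀.symm)
  have n9 : x₀ ≠ c₀ := by
    intro e
    rw [e] at hx₀
    exact n1 (by rw [← hm' a₀, hx₀, e2])
  have key : ∀ σ : Equiv.Perm V, δ (σ a₀) (σ b₀) - δ (σ c₀) (σ b₀) + δ (σ c₀) (σ d₀) -
      δ (σ a₀) (σ d₀) = δ (σ a₀) (σ x₀) - δ (σ c₀) (σ x₀) + δ (σ c₀) (σ b₀) - δ (σ a₀) (σ b₀) := by
    intro σ
    have h1 := sum_matching_sub_swap hm hm1 (δ := fun u v => δ (σ u) (σ v)) (fun _ _ => hδ _ _) n3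
      (by rw [e1]; exact n2.symm)
    have h2 := sum_matching_sub_swap hm' hm1' (δ := fun u v => δ (σ u) (σ v)) (fun _ _ => hδ _ _) n3
      (by rw [hx₀]; exact n9)
    have h3 := h σ
    have h4 := h ((Equiv.swap a₀ c₀).trans σ)
    simp only [Equiv.trans_apply] at h4
    rw [e1, hd₀] at h1
    rw [hx₀, e2] at h2
    linarith
  by_cases hdx : d₀ = x₀
  · obtain ⟨σ, hσ⟩ := exists_equiv_of_injective (α := V) (β := V) rfl (u := ![a₀, b₀, c₀, d₀])
      (w := ![a, b, c, d])
      (by simp [Function.Injective, Fin.forall_fin_succ, n1, n2, n3, n4, n5, n6, n1.symm, n2.symm,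
          n3.symm, n4.symm, n5.symm, n6.symm])
      (by simp [Function.Injective, Fin.forall_fin_succ, hab, hac, had, hbc, hbd, hcd, hab.symm,
          hac.symm, had.symm, hbc.symm, hbd.symm, hcd.symm])
    simp only [Fin.forall_fin_succ, Matrix.cons_val_zero, Matrix.cons_val_succ] at hσ
    have := key σ
    rw [← hdx, hσ.1, hσ.2.1, hσ.2.2.1, hσ.2.2.2.1] at this
    rw [hδ b c]
    linarith
  · have hu : Function.Injective ![a₀, b₀, c₀, d₀, x₀] := by
      simp [Function.Injective, Fin.forall_fin_succ, n1, n2, n3, n4, n5, n6, n7, n8, n9, n1.symm,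
        n2.symm, n3.symm, n4.symm, n5.symm, n6.symm, n7.symm, n8.symm, n9.symm, hdx, Ne.symm hdx]
    have key' : ∀ b d x, a ≠ b → a ≠ d → a ≠ x → c ≠ b → c ≠ d → c ≠ x → b ≠ d → b ≠ x → d ≠ x →
        2 * (δ a b - δ c b) = (δ a d - δ c d) + (δ a x - δ c x) := by
      intro b d x m1 m2 m3 m4 m5 m6 m7 m8 m9
      obtain ⟨σ, hσ⟩ := exists_equiv_of_injective (α := V) (β := V) rfl hu (w := ![a, b, c, d, x])
        (by simp [Function.Injective, Fin.forall_fin_succ, m1, m2, m3, m4, m5, m6, m7, m8, m9, hac,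
            m1.symm, m2.symm, m3.symm, m4.symm, m5.symm, m6.symm, m7.symm, m8.symm, m9.symm,
            hac.symm])
      simp only [Fin.forall_fin_succ, Matrix.cons_val_zero, Matrix.cons_val_succ] at hσ
      have := key σ
      rw [hσ.1, hσ.2.1, hσ.2.2.1, hσ.2.2.2.1, hσ.2.2.2.2.1] at this
      linarith
    obtain ⟨x, hx⟩ : ∃ x, x ∉ ({a, b, c, d} : Finset V) := by
      by_contra hcon
      push Not at hcon
      have h1 : Fintype.card V ≤ 4 := by
        rw [← Finset.card_univ]
        exact (Finset.card_le_card (fun x _ => hcon x)).trans Finset.card_le_four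
      have h2 := Fintype.card_le_of_injective _ hu
      simp at h2
      omega
    simp only [Finset.mem_insert, Finset.mem_singleton, not_or] at hx
    obtain ⟨x1, x2, x3, x4⟩ := hx
    have h1 := key' b d x hab had (Ne.symm x1) hbc.symm hcd (Ne.symm x3) hbd (Ne.symm x2)
      (Ne.symm x4)
    have h2 := key' d b x had hab (Ne.symm x1) hcd hbc.symm (Ne.symm x3) hbd.symm (Ne.symm x4)
      (Ne.symm x2)
    rw [hδ b c]
    linarith

/-- A symmetric edge weight whose alternating sum over each 4-cycle vanishes is a sum of vertex
weights. -/
lemma exists_potential {V : Type*} [Fintype V] (hV : 3 ≤ Fintype.card V) {δ : V → V → ℝ}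
    (hδ : ∀ a b, δ a b = δ b a)
    (h : ∀ a b c d, a ≠ b → a ≠ c → a ≠ d → b ≠ c → b ≠ d → c ≠ d →
      δ a b + δ c d = δ b c + δ a d) :
    ∃ φ : V → ℝ, ∀ a b, a ≠ b → δ a b = φ a + φ b := by
  have h1 : ∀ a : V, ∃ b c, a ≠ b ∧ a ≠ c ∧ b ≠ c := by
    intro a
    obtain ⟨b, hb, c, hc, hbc⟩ := Finset.one_lt_card.1 (show 1 < (Finset.univ.erase a).card by
      rw [Finset.card_erase_of_mem (Finset.mem_univ _), Finset.card_univ]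
      omega)
    exact ⟨b, c, (Finset.ne_of_mem_erase hb).symm, (Finset.ne_of_mem_erase hc).symm, hbc⟩
  have h2 : ∀ a b c c', a ≠ b → a ≠ c → b ≠ c → a ≠ c' → b ≠ c' →
      δ a b + δ a c - δ b c = δ a b + δ a c' - δ b c' := by
    intro a b c c' n1 n2 n3 n4 n5
    by_cases hc : c = c'
    · rw [hc]
    · have := h a c b c' n2 n1 n4 n3.symm hc n5
      rw [hδ c b] at this
      linarith
  have h2' : ∀ a b b' c, a ≠ b → a ≠ c → b ≠ c → a ≠ b' → b' ≠ c →
      δ a b + δ a c - δ b c = δ a b' + δ a c - δ b' c := by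
    intro a b b' c n1 n2 n3 n4 n5
    have := h2 a c b b' n2 n1 n3.symm n4 n5.symm
    rw [hδ c b, hδ c b'] at this
    linarith
  have h3 : ∀ a b c b' c', a ≠ b → a ≠ c → b ≠ c → a ≠ b' → a ≠ c' → b' ≠ c' →
      δ a b + δ a c - δ b c = δ a b' + δ a c' - δ b' c' := by
    intro a b c b' c' n1 n2 n3 n4 n5 n6
    by_cases hb : b = c'
    · subst hb
      by_cases hc : c = b'
      · subst hc
        rw [hδ c b]
        ring
      · rw [h2' a b b' c n1 n2 n3 n4 (Ne.symm hc), h2 a b' c b n4 n2 (Ne.symm hc) n5 n6]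
    · rw [h2 a b c c' n1 n2 n3 n5 hb, h2' a b b' c' n1 n5 hb n4 n6]
  choose f g hf hg hfg using h1
  refine ⟨fun a => (δ a (f a) + δ a (g a) - δ (f a) (g a)) / 2, fun a b hab => ?_⟩
  obtain ⟨c, hc⟩ : ∃ c, c ∉ ({a, b} : Finset V) := by
    by_contra hcon
    push Not at hcon
    have h1 : Fintype.card V ≤ 2 := by
      rw [← Finset.card_univ]
      exact (Finset.card_le_card (fun x _ => hcon x)).trans Finset.card_le_two
    omega
  simp only [Finset.mem_insert, Finset.mem_singleton, not_or] at hc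
  have e1 := h3 a (f a) (g a) b c (hf a) (hg a) (hfg a) hab (Ne.symm hc.1) (Ne.symm hc.2)
  have e2 := h3 b (f b) (g b) a c (hf b) (hg b) (hfg b) hab.symm (Ne.symm hc.2) (Ne.symm hc.1)
  simp only [e1, e2]
  rw [hδ b a]
  ring

end Matchings

section SlotSwap

variable {n : ℕ} {κ : Team n → Team n → Fin (n - 1)}

lemma IsColoring.sum_color (hκ : IsColoring n κ) {ε : Team n → Team n → Bool}
    (hε : ∀ a b, a ≠ b → ε b a = !ε a b) {δ : Team n → Team n → ℝ} (hδ : ∀ a b, δ a b = δ b a)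
    (hδ0 : ∀ a, δ a a = 0) {x : Fin (n - 1)} {m : Team n → Team n} (hm : ∀ a, m a ≠ a)
    (hmx : ∀ a, κ a (m a) = x) :
    2 * ∑ p : Team n × Team n, (if κ p.1 p.2 = x ∧ ε p.1 p.2 = true then δ p.1 p.2 else 0) =
      ∑ a, δ a (m a) := by
  have h1 : ∑ p : Team n × Team n, (if κ p.1 p.2 = x ∧ ε p.1 p.2 = true then δ p.1 p.2 else 0) =
      ∑ p : Team n × Team n, (if κ p.2 p.1 = x ∧ ε p.2 p.1 = true then δ p.2 p.1 else 0) :=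
    ((Equiv.prodComm (Team n) (Team n)).sum_comp _).symm
  rw [two_mul]
  nth_rewrite 2 [h1]
  rw [← Finset.sum_add_distrib, Fintype.sum_prod_type]
  refine Finset.sum_congr rfl fun a _ => ?_
  rw [Fintype.sum_eq_single (m a)]
  · simp only [hκ.symm (m a) a, hmx a, hε a (m a) (hm a).symm, hδ (m a) a, true_and]
    cases ε a (m a) <;> simp
  · intro b hb
    by_cases hab : a = b
    · subst hab
      simp [hδ0]
    · have : κ a b ≠ x := fun h => hb (hκ.inj _ _ _ hab (hm a).symm (h.trans (hmx a).symm))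
      have h' : κ b a ≠ x := by rwa [hκ.symm]
      simp [this, h']

lemma IsColoring.sum_eq_of_weight_eq (hκ : IsColoring n κ) {ε : Team n → Team n → Bool}
    (hε : ∀ a b, a ≠ b → ε b a = !ε a b) {c : ℕ → Team n → Team n → ℝ}
    (hc0 : ∀ p a, c p a a = 0) {x y : Fin (n - 1)} (hxy : x ≠ y)
    (g : Fin (n - 1) × Bool ≃ Finset.Icc 1 (2 * n - 2)) {p q : ℕ}
    (hp : (g (x, true) : ℕ) = p) (hq : (g (y, true) : ℕ) = q)
    (hδ : ∀ a b, c p a b - c q a b = c p b a - c q b a)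
    {m m' : Team n → Team n} (hm : ∀ a, m a ≠ a) (hmx : ∀ a, κ a (m a) = x)
    (hm' : ∀ a, m' a ≠ a) (hmy : ∀ a, κ a (m' a) = y)
    (hw : weight c (schedOf κ g ε) =
      weight c (schedOf κ (g.trans (Equiv.swap (g (x, true)) (g (y, true)))) ε)) :
    ∑ a, (c p a (m a) - c q a (m a)) = ∑ a, (c p a (m' a) - c q a (m' a)) := by
  have h1 := hκ.sum_color hε (δ := fun a b => c p a b - c q a b) hδ (by simp [hc0]) hm hmx
  have h2 := hκ.sum_color hε (δ := fun a b => c p a b - c q a b) hδ (by simp [hc0]) hm' hmy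
  rw [← h1, ← h2]
  rw [← sub_eq_zero, weight, weight, ← Finset.sum_sub_distrib] at hw
  rw [← sub_eq_zero, ← mul_sub, ← Finset.sum_sub_distrib, mul_eq_zero]
  right
  refine Eq.trans ?_ hw
  refine Finset.sum_congr rfl fun r _ => ?_
  simp only [schedOf, Equiv.trans_apply]
  by_cases e1 : (κ r.1 r.2, ε r.1 r.2) = (x, true)
  · rw [e1, Equiv.swap_apply_left, hp, hq]
    rw [Prod.mk.injEq] at e1
    simp [e1, hxy]
  · by_cases e2 : (κ r.1 r.2, ε r.1 r.2) = (y, true)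
    · rw [e2, Equiv.swap_apply_right, hp, hq]
      rw [Prod.mk.injEq] at e2
      simp [e2, hxy.symm]
    · rw [Equiv.swap_apply_of_ne_of_ne (g.injective.ne e1) (g.injective.ne e2)]
      rw [Prod.mk.injEq] at e1 e2
      simp [e1, e2]

end SlotSwap

section Tightness

variable {n : ℕ} {τ : Team n → Team n → ℕ}

lemma travel_nonneg (n : ℕ) (T : Set (ℕ × ℕ × ℕ)) (p : ℕ × ℕ × ℕ) : 0 ≤ travel n T p := by
  unfold travel
  split_ifs <;> norm_num

lemma travel_eq_zero_or_one (n : ℕ) (T : Set (ℕ × ℕ × ℕ)) (p : ℕ × ℕ × ℕ) :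
    travel n T p = 0 ∨ travel n T p = 1 := by
  unfold travel
  split_ifs <;> simp

lemma IsSched.travel_home_away_eq_one (h : IsSched n τ) {u b : Team n} (hub : u ≠ b) {p : ℕ}
    (hp : τ b u = p + 1) (hh : p = 0 ∨ HomeAt τ u p) :
    travel n (matchSet τ) (u, u, b) = 1 := by
  have hm := Finset.mem_Icc.1 (h.mem b u hub.symm)
  rw [travel, if_pos]
  refine ⟨p, by omega, ?_, ?_⟩
  · rcases hh with rfl | ⟨v, hv, rfl⟩
    · exact h.venue_zero u
    · exact h.venue_mem _ _ _ hv (Or.inl rfl)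
  · simp only
    rw [← hp]
    exact h.venue_mem _ _ _ hub.symm (Or.inr rfl)

lemma IsSched.travel_home_away_eq_zero (h : IsSched n τ) {u b : Team n} (hub : u ≠ b) {p : ℕ}
    (hp : τ b u = p + 1) (ha : AwayAt τ u p) : travel n (matchSet τ) (u, u, b) = 0 := by
  rw [travel, if_neg]
  rintro ⟨l, -, h1, h2⟩
  have h3 := venue_matchSet h2 hub.symm
  obtain rfl : p = l := by omega
  obtain ⟨v, hv, rfl⟩ := ha
  rw [h.venue_mem _ _ _ hv.symm (Or.inr rfl)] at h1
  exact hv (Subtype.ext h1).symm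

lemma IsSched.travel_away_home_eq_zero (h : IsSched n τ) {u a : Team n} (hua : u ≠ a) {p : ℕ}
    (hp : τ a u = p) (ha : AwayAt τ u (p + 1)) : travel n (matchSet τ) (u, a, u) = 0 := by
  rw [travel, if_neg]
  rintro ⟨l, -, h1, h2⟩
  have h3 := venue_matchSet h1 hua.symm
  obtain rfl : p = l := by omega
  obtain ⟨v, hv, hv'⟩ := ha
  rw [← hv', h.venue_mem _ _ _ hv.symm (Or.inr rfl)] at h2
  exact hv (Subtype.ext h2).symm

lemma travel_away_away_eq_zero {u a b : Team n} (hua : u ≠ a) (hub : u ≠ b)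
    (hne : τ b u ≠ τ a u + 1) : travel n (matchSet τ) (u, a, b) = 0 := by
  rw [travel, if_neg]
  rintro ⟨l, -, h1, h2⟩
  exact hne ((venue_matchSet h2 hub.symm).trans
    (congrArg (· + 1) (venue_matchSet h1 hua.symm).symm))

/-- The lifted home-away inequality is tight at `τ` with the travel variable at its minimum. -/
def Tight (k : ℕ) (t j : Team n) (τ : Team n → Team n → ℕ) : Prop :=
  (if τ j t = 1 then (1 : ℝ) else 0) + (if τ j t = k then 1 else 0) +
    (if HomeAt τ t k then 1 else 0) + (if τ j t = k + 1 then 1 else 0) -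
      travel n (matchSet τ) (t, t, j) = 1

variable {k : ℕ} {t j : Team n}

lemma IsSched.lifted_le (h : IsSched n τ) (hk : 1 ≤ k) (htj : t ≠ j) :
    (if τ j t = 1 then (1 : ℝ) else 0) + (if τ j t = k then 1 else 0) +
    (if HomeAt τ t k then 1 else 0) + (if τ j t = k + 1 then 1 else 0) -
      travel n (matchSet τ) (t, t, j) ≤ 1 := by
  have h0 := travel_nonneg n (matchSet τ) (t, t, j)
  have ha : τ j t = k → ¬HomeAt τ t k := fun e => h.not_homeAt ⟨j, htj, e⟩
  by_cases h1 : τ j t = 1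
  · rw [h.travel_home_away_eq_one htj (p := 0) h1 (Or.inl rfl)]
    have h2 : 1 ≠ k + 1 := by omega
    rw [h1] at ha ⊢
    have h5 : k ≠ 0 := by omega
    by_cases h3 : 1 = k
    · simp [h3, ha h3, h5]
    · simp only [h2, h3, if_true, if_false]
      split_ifs <;> norm_num
  · by_cases h2 : τ j t = k
    · have h3 : k ≠ k + 1 := by omega
      have h4 := ha h2
      rw [h2] at h1 ⊢
      simp [h1, h4, h0]
    · by_cases h3 : τ j t = k + 1
      · by_cases h4 : HomeAt τ t k
        · rw [h.travel_home_away_eq_one htj h3 (Or.inr h4)]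
          have h5 : k ≠ 0 := by omega
          simp [h3, h4, h5]
        · simp [h3, h4]
          split_ifs <;> linarith
      · simp only [h1, h2, h3, if_false]
        split_ifs <;> linarith

lemma IsSched.tight_of_first (h : IsSched n τ) (htj : t ≠ j) (hk : 1 ≤ k) (h1 : τ j t = 1)
    (h2 : k = 1 ∨ HomeAt τ t k) : Tight k t j τ := by
  have h3 : 1 ≠ k + 1 := by omega
  unfold Tight
  rw [h.travel_home_away_eq_one htj (p := 0) h1 (Or.inl rfl), h1]
  by_cases hk1 : k = 1
  · subst hk1
    have h4 : ¬HomeAt τ t 1 := h.not_homeAt ⟨j, htj, h1⟩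
    simp [h4]
  · have h4 := h2.resolve_left hk1
    have h5 : k ≠ 0 := by omega
    simp [h4, Ne.symm hk1, h5]

lemma IsSched.tight_of_at (h : IsSched n τ) (htj : t ≠ j) {l : ℕ} (hk : k = l + 1)
    (h1 : τ j t = k) (h2 : AwayAt τ t l) (hl : l ≠ 0) : Tight k t j τ := by
  have h4 : ¬HomeAt τ t k := h.not_homeAt ⟨j, htj, h1⟩
  have h5 : k ≠ 1 := by omega
  unfold Tight
  rw [h.travel_home_away_eq_zero htj (p := l) (h1.trans hk) h2, h1]
  simp [h4, h5]

lemma IsSched.tight_of_next (h : IsSched n τ) (htj : t ≠ j) (hk : k ∈ Finset.Icc 1 (2 * n - 2))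
    (h1 : τ j t = k + 1) : Tight k t j τ := by
  have h5 : k ≠ 0 := by
    have := Finset.mem_Icc.1 hk
    omega
  unfold Tight
  rcases h.homeAt_or_awayAt t hk with h2 | h2
  · rw [h.travel_home_away_eq_one htj h1 (Or.inr h2), h1]
    simp [h2, h5]
  · have h4 := h.not_homeAt h2
    rw [h.travel_home_away_eq_zero htj h1 h2, h1]
    simp [h4, h5]

lemma IsSched.tight_of_away_before (h : IsSched n τ) (htj : t ≠ j) {l : ℕ} (h1 : τ j t = l + 1)
    (h2 : AwayAt τ t l) (h3 : HomeAt τ t k) (hl : l ≠ 0) (hlk : l + 1 ≠ k) (hlk' : l ≠ k) :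
    Tight k t j τ := by
  unfold Tight
  rw [h.travel_home_away_eq_zero htj h1 h2, h1]
  simp [h3, hl, hlk, hlk']

end Tightness

lemma exists_slot {n : ℕ} (hn : 4 ≤ n) (S : Finset ℕ) (hS : S.card ≤ 5) :
    ∃ r ∈ Finset.Icc 1 (2 * n - 2), r ∉ S := by
  apply Finset.exists_mem_notMem_of_card_lt_card
  rw [Nat.card_Icc]
  omega

lemma exists_home_slot {n k : ℕ} (hn : 4 ≤ n) (hk1 : 1 ≤ k) (hk2 : k + 1 ≤ 2 * n - 2) :
    ∃ k' ∈ Finset.Icc 1 (2 * n - 2), k' ≠ 1 ∧ k' ≠ k + 1 ∧ (k = 1 ∨ k' = k) := by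
  by_cases hk : k = 1
  · exact ⟨3, Finset.mem_Icc.2 ⟨by norm_num, by omega⟩, by norm_num, by omega, Or.inl hk⟩
  · exact ⟨k, Finset.mem_Icc.2 ⟨hk1, by omega⟩, hk, by omega, Or.inr rfl⟩

section Functional

variable {n : ℕ} {k : ℕ} {t j : Team n} {c : ℕ → Team n → Team n → ℝ}

lemma flip_relation {τ : Team n → Team n → ℕ}
    (H : ∀ τ τ', IsSched n τ → IsSched n τ' → Tight k t j τ → Tight k t j τ' →
      weight c τ = weight c τ') {a b : Team n} (hab : a ≠ b) (hτ : IsSched n τ)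
    (h1 : Tight k t j τ) (h2 : Tight k t j (flip τ a b)) :
    c (τ b a) a b - c (τ b a) b a = c (τ a b) a b - c (τ a b) b a := by
  have h3 := weight_flip c hab (τ := τ)
  rw [H _ _ (hτ.flip a b) hτ h2 h1, sub_self] at h3
  linarith

/-- Team `a ∈ {t, j}` plays `b ∉ {t, j}` in prescribed slots, as do `t` and `j`. -/
lemma exists_sched_meeting (hn : 4 ≤ n) (heven : Even n) (htj : t ≠ j) {a b : Team n}
    (ha : a = t ∨ a = j) (hbt : b ≠ t) (hbj : b ≠ j) {p q p' q' : ℕ}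
    (hp : p ∈ Finset.Icc 1 (2 * n - 2)) (hq : q ∈ Finset.Icc 1 (2 * n - 2))
    (hp' : p' ∈ Finset.Icc 1 (2 * n - 2)) (hq' : q' ∈ Finset.Icc 1 (2 * n - 2))
    (h1 : p ≠ q) (h2 : p ≠ p') (h3 : p ≠ q') (h4 : q ≠ p') (h5 : q ≠ q') (h6 : p' ≠ q') :
    ∃ τ, IsSched n τ ∧ τ a b = p ∧ τ b a = q ∧ τ j t = p' ∧ τ t j = q' := by
  rcases ha with rfl | rfl
  · obtain ⟨τ, e1, e2, e3, e4, e5⟩ := exists_sched_adjacent hn heven hbt.symm htj hbj hp hq hq' hp'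
      h1 h3 h2 h5 h4 h6.symm
    exact ⟨τ, e1, e2, e3, e5, e4⟩
  · obtain ⟨τ, e1, e2, e3, e4, e5⟩ := exists_sched_adjacent hn heven hbj.symm htj.symm hbt hp hq
      hp' hq' h1 h2 h3 h4 h5 h6
    exact ⟨τ, e1, e2, e3, e4, e5⟩

lemma asymmetry_const_adjacent (hn : 4 ≤ n) (heven : Even n) (hk1 : 1 ≤ k)
    (hk2 : k + 1 ≤ 2 * n - 2) (htj : t ≠ j)
    (H : ∀ τ τ', IsSched n τ → IsSched n τ' → Tight k t j τ → Tight k t j τ' →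
      weight c τ = weight c τ') {a b : Team n} (ha : a = t ∨ a = j) (hbt : b ≠ t) (hbj : b ≠ j)
    {p q : ℕ} (hp : p ∈ Finset.Icc 1 (2 * n - 2)) (hq : q ∈ Finset.Icc 1 (2 * n - 2)) :
    c p a b - c p b a = c q a b - c q b a := by
  have hk : k ∈ Finset.Icc 1 (2 * n - 2) := Finset.mem_Icc.2 ⟨hk1, by omega⟩
  have hK : k + 1 ∈ Finset.Icc 1 (2 * n - 2) := Finset.mem_Icc.2 ⟨by omega, hk2⟩
  have h1 : 1 ∈ Finset.Icc 1 (2 * n - 2) := Finset.mem_Icc.2 ⟨le_rfl, by omega⟩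
  have hab : a ≠ b := by
    rcases ha with rfl | rfl
    · exact hbt.symm
    · exact hbj.symm
  have hfl : ∀ τ : Team n → Team n → ℕ, flip τ a b j t = τ j t ∧ flip τ a b t j = τ t j := by
    intro τ
    constructor <;> apply flip_of_ne <;> grind
  have main : ∀ p ∈ Finset.Icc 1 (2 * n - 2), ∀ q ∈ Finset.Icc 1 (2 * n - 2), p ≠ k + 1 →
      q ≠ k + 1 → c p a b - c p b a = c q a b - c q b a := by
    intro p hp q hq hpk hqk
    by_cases hpq : q = p
    · rw [hpq]
    obtain ⟨r, hr, hr'⟩ := exists_slot hn {p, q, k + 1} (Finset.card_le_three.trans (by norm_num))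
    simp only [Finset.mem_insert, Finset.mem_singleton, not_or] at hr'
    obtain ⟨τ, e1, e2, e3, e4, -⟩ := exists_sched_meeting hn heven htj ha hbt hbj hq hp hK hr
      hpq hqk (Ne.symm hr'.2.1) hpk (Ne.symm hr'.1) (Ne.symm hr'.2.2)
    have := flip_relation H hab e1 (e1.tight_of_next htj hk e4)
      ((e1.flip a b).tight_of_next htj hk ((hfl τ).1.trans e4))
    rwa [e2, e3] at this
  obtain ⟨k', hk', hk'1⟩ := exists_home_slot hn hk1 hk2
  obtain ⟨r, hr, hr'⟩ := exists_slot hn {1, k', k + 1} (Finset.card_le_three.trans (by norm_num))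
  simp only [Finset.mem_insert, Finset.mem_singleton, not_or] at hr'
  have hKr : c (k + 1) a b - c (k + 1) b a = c r a b - c r b a := by
    obtain ⟨τ, e1, e2, e3, e4, e5⟩ := exists_sched_meeting hn heven htj ha hbt hbj hr hK h1 hk'
      hr'.2.2 hr'.1 hr'.2.1 (by omega) (Ne.symm hk'1.2.1) (Ne.symm hk'1.1)
    have := flip_relation H hab e1
      (e1.tight_of_first htj hk1 e4 (hk'1.2.2.imp id fun e => ⟨j, htj, e5.trans e⟩))
      ((e1.flip a b).tight_of_first htj hk1 ((hfl τ).1.trans e4)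
        (hk'1.2.2.imp id fun e => ⟨j, htj, (hfl τ).2.trans (e5.trans e)⟩))
    rwa [e2, e3] at this
  have all : ∀ p ∈ Finset.Icc 1 (2 * n - 2), c p a b - c p b a = c r a b - c r b a := by
    intro p hp
    by_cases hpK : p = k + 1
    · rw [hpK, hKr]
    · exact main p hp r hr hpK hr'.2.2
  rw [all p hp, all q hq]

lemma asymmetry_const_disjoint (hn : 4 ≤ n) (heven : Even n) (hk1 : 1 ≤ k)
    (hk2 : k + 1 ≤ 2 * n - 2) (htj : t ≠ j)
    (H : ∀ τ τ', IsSched n τ → IsSched n τ' → Tight k t j τ → Tight k t j τ' →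
      weight c τ = weight c τ') {a b : Team n} (hab : a ≠ b) (hat : a ≠ t) (haj : a ≠ j)
    (hbt : b ≠ t) (hbj : b ≠ j)
    {p q : ℕ} (hp : p ∈ Finset.Icc 1 (2 * n - 2)) (hq : q ∈ Finset.Icc 1 (2 * n - 2)) :
    c p a b - c p b a = c q a b - c q b a := by
  have hk : k ∈ Finset.Icc 1 (2 * n - 2) := Finset.mem_Icc.2 ⟨hk1, by omega⟩
  have hK : k + 1 ∈ Finset.Icc 1 (2 * n - 2) := Finset.mem_Icc.2 ⟨by omega, hk2⟩
  have all : ∀ p ∈ Finset.Icc 1 (2 * n - 2),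
      c p a b - c p b a = c (k + 1) a b - c (k + 1) b a := by
    intro p hp
    by_cases hpK : k + 1 = p
    · rw [hpK]
    obtain ⟨τ, e1, e2, e3, e4, -⟩ := exists_sched_disjoint hn heven hab haj hat hbj hbt htj.symm
      hK hp hpK
    have := flip_relation H hab e1 (e1.tight_of_next htj hk e4)
      ((e1.flip a b).tight_of_next htj hk (by
        rw [flip_of_ne (fun h => haj h.1.symm) (fun h => hbj h.1.symm), e4]))
    rwa [e2, e3] at this
  rw [all p hp, all q hq]

lemma HomeAt.flip {τ : Team n → Team n → ℕ} {u : Team n} {r : ℕ} (h : HomeAt τ u r) {a b : Team n}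
    (h1 : τ a b ≠ r) (h2 : τ b a ≠ r) : HomeAt (flip τ a b) u r := by
  obtain ⟨v, hv, hv'⟩ := h
  refine ⟨v, hv, ?_⟩
  rw [flip_of_ne, hv']
  · rintro ⟨rfl, rfl⟩
    exact h1 hv'
  · rintro ⟨rfl, rfl⟩
    exact h2 hv'

lemma AwayAt.flip {τ : Team n → Team n → ℕ} {u : Team n} {r : ℕ} (h : AwayAt τ u r) {a b : Team n}
    (h1 : τ a b ≠ r) (h2 : τ b a ≠ r) : AwayAt (flip τ a b) u r := by
  obtain ⟨v, hv, hv'⟩ := h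
  refine ⟨v, hv, ?_⟩
  rw [flip_of_ne, hv']
  · rintro ⟨rfl, rfl⟩
    exact h1 hv'
  · rintro ⟨rfl, rfl⟩
    exact h2 hv'

lemma asymmetry_const_pair (hn : 4 ≤ n) (heven : Even n) (hk1 : 1 ≤ k)
    (hk2 : k + 1 ≤ 2 * n - 2) (htj : t ≠ j)
    (H : ∀ τ τ', IsSched n τ → IsSched n τ' → Tight k t j τ → Tight k t j τ' →
      weight c τ = weight c τ') {p q : ℕ} (hp : p ∈ Finset.Icc 1 (2 * n - 2))
    (hq : q ∈ Finset.Icc 1 (2 * n - 2)) :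
    c p j t - c p t j = c q j t - c q t j := by
  have hk : k ∈ Finset.Icc 1 (2 * n - 2) := Finset.mem_Icc.2 ⟨hk1, by omega⟩
  have hK : k + 1 ∈ Finset.Icc 1 (2 * n - 2) := Finset.mem_Icc.2 ⟨by omega, hk2⟩
  have h1 : 1 ∈ Finset.Icc 1 (2 * n - 2) := Finset.mem_Icc.2 ⟨le_rfl, by omega⟩
  have first : c 1 j t - c 1 t j = c (k + 1) j t - c (k + 1) t j := by
    obtain ⟨τ₀, e1, e2, e3⟩ := exists_sched_pair hn heven htj.symm hK h1 (by omega)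
    by_cases hk0 : k = 1
    · have := flip_relation H htj.symm e1 (e1.tight_of_next htj hk e2)
        ((e1.flip j t).tight_of_first htj hk1 (by rw [flip_left, e3]) (Or.inl hk0))
      rwa [e2, e3] at this
    · obtain ⟨τ, f1, f2, f3⟩ := e1.exists_homeAt t hk
      replace ⟨e2, e3⟩ := And.intro ((f3 j t (by omega) (by omega)).trans e2)
        ((f3 t j (by omega) (by omega)).trans e3)
      have := flip_relation H htj.symm f1 (f1.tight_of_next htj hk e2)
        ((f1.flip j t).tight_of_first htj hk1 (by rw [flip_left, e3])
          (Or.inr (f2.flip (by omega) (by omega))))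
      rwa [e2, e3] at this
  have all : ∀ p ∈ Finset.Icc 1 (2 * n - 2),
      c p j t - c p t j = c (k + 1) j t - c (k + 1) t j := by
    intro p hp
    have hp' := Finset.mem_Icc.1 hp
    by_cases hp1 : p = 1
    · rw [hp1, first]
    by_cases hpK : p = k + 1
    · rw [hpK]
    obtain ⟨l, rfl⟩ : ∃ l, p = l + 1 := ⟨p - 1, by omega⟩
    have hl : l ∈ Finset.Icc 1 (2 * n - 2) := Finset.mem_Icc.2 ⟨by omega, by omega⟩
    by_cases hpk : l + 1 = k
    · obtain ⟨τ₀, e1, e2, e3⟩ := exists_sched_pair hn heven htj.symm hK hp (by omega)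
      obtain ⟨τ, f1, f2, f3⟩ := e1.exists_awayAt t hl
      replace ⟨e2, e3⟩ := And.intro ((f3 j t (by omega) (by omega)).trans e2)
        ((f3 t j (by omega) (by omega)).trans e3)
      have := flip_relation H htj.symm f1 (f1.tight_of_next htj hk e2)
        ((f1.flip j t).tight_of_at htj hpk.symm (by rw [flip_left, e3, hpk])
          (f2.flip (by omega) (by omega)) (by omega))
      rwa [e2, e3] at this
    by_cases hlK : l = k + 1
    · rw [← first]
      obtain ⟨τ₀, e1, e2, e3⟩ := exists_sched_pair hn heven htj.symm h1 hp (by omega)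
      have goal_of : ∀ τ, IsSched n τ → τ j t = 1 → τ t j = l + 1 → AwayAt τ t l →
          (k = 1 ∨ HomeAt τ t k) →
          c (l + 1) j t - c (l + 1) t j = c 1 j t - c 1 t j := by
        intro τ f1 e2 e3 f2 f3
        have hH : HomeAt (flip τ j t) t k := by
          by_cases hk0 : k = 1
          · exact ⟨j, htj, by rw [flip_right, e2, hk0]⟩
          · exact (f3.resolve_left hk0).flip (by omega) (by omega)
        have := flip_relation H htj.symm f1 (f1.tight_of_first htj hk1 e2 f3)
          ((f1.flip j t).tight_of_away_before htj (by rw [flip_left, e3])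
            (f2.flip (by omega) (by omega)) hH (by omega) (by omega) (by omega))
        rwa [e2, e3] at this
      by_cases hk0 : k = 1
      · obtain ⟨τ, f1, f2, f3⟩ := e1.exists_awayAt t hl
        replace ⟨e2, e3⟩ := And.intro ((f3 j t (by omega) (by omega)).trans e2)
          ((f3 t j (by omega) (by omega)).trans e3)
        exact goal_of τ f1 e2 e3 f2 (Or.inl hk0)
      · obtain ⟨τ, f1, f4, f2, f3⟩ := e1.exists_homeAt_awayAt t hk hl (by omega)
        replace ⟨e2, e3⟩ := And.intro ((f3 j t (by omega) (by omega) (by omega) (by omega)).trans e2)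
          ((f3 t j (by omega) (by omega) (by omega) (by omega)).trans e3)
        exact goal_of τ f1 e2 e3 f2 (Or.inr f4)
    · obtain ⟨τ₀, e1, e2, e3⟩ := exists_sched_pair hn heven htj.symm hK hp (by omega)
      obtain ⟨τ, f1, f4, f2, f3⟩ := e1.exists_homeAt_awayAt t hk hl (by omega)
      replace ⟨e2, e3⟩ := And.intro ((f3 j t (by omega) (by omega) (by omega) (by omega)).trans e2)
        ((f3 t j (by omega) (by omega) (by omega) (by omega)).trans e3)
      have := flip_relation H htj.symm f1 (f1.tight_of_next htj hk e2)
        ((f1.flip j t).tight_of_away_before htj (by rw [flip_left, e3])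
          (f2.flip (by omega) (by omega)) (f4.flip (by omega) (by omega)) (by omega) hpk
          (by omega))
      rwa [e2, e3] at this
  rw [all p hp, all q hq]

lemma asymmetry_const (hn : 4 ≤ n) (heven : Even n) (hk1 : 1 ≤ k)
    (hk2 : k + 1 ≤ 2 * n - 2) (htj : t ≠ j)
    (H : ∀ τ τ', IsSched n τ → IsSched n τ' → Tight k t j τ → Tight k t j τ' →
      weight c τ = weight c τ') (a b : Team n) {p q : ℕ}
    (hp : p ∈ Finset.Icc 1 (2 * n - 2)) (hq : q ∈ Finset.Icc 1 (2 * n - 2)) :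
    c p a b - c p b a = c q a b - c q b a := by
  by_cases hab : a = b
  · subst hab
    simp
  have hadj : ∀ a b : Team n, (a = t ∨ a = j) → b ≠ t → b ≠ j →
      c p a b - c p b a = c q a b - c q b a := fun a b h1 h2 h3 =>
    asymmetry_const_adjacent hn heven hk1 hk2 htj H h1 h2 h3 hp hq
  by_cases ha : a = t ∨ a = j
  · by_cases hb : b = t ∨ b = j
    · have := asymmetry_const_pair hn heven hk1 hk2 htj H hp hq
      rcases ha with rfl | rfl <;> rcases hb with rfl | rfl
      · exact absurd rfl hab
      · linarith
      · exact this
      · exact absurd rfl hab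
    · push Not at hb
      exact hadj a b ha hb.1 hb.2
  · push Not at ha
    by_cases hb : b = t ∨ b = j
    · linarith [hadj b a hb ha.1 ha.2]
    · push Not at hb
      exact asymmetry_const_disjoint hn heven hk1 hk2 htj H hab ha.1 ha.2 hb.1 hb.2 hp hq

end Functional

section Potential

variable {n : ℕ} {k : ℕ} {t j : Team n} {c : ℕ → Team n → Team n → ℝ}
  {κ : Team n → Team n → Fin (n - 1)} {x y : Fin (n - 1)} {m m' : Team n → Team n}

lemma sum_neighbor_eq_of_ne (hn : 4 ≤ n) (heven : Even n) (hk1 : 1 ≤ k)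
    (hk2 : k + 1 ≤ 2 * n - 2) (htj : t ≠ j) (hc0 : ∀ p a, c p a a = 0)
    (H : ∀ τ τ', IsSched n τ → IsSched n τ' → Tight k t j τ → Tight k t j τ' →
      weight c τ = weight c τ')
    (hκ : IsColoring n κ) (hxy : x ≠ y) (hm : ∀ a, m a ≠ a) (hmx : ∀ a, κ a (m a) = x)
    (hm' : ∀ a, m' a ≠ a) (hmy : ∀ a, κ a (m' a) = y) {p q : ℕ}
    (hp : p ∈ Finset.Icc 1 (2 * n - 2)) (hq : q ∈ Finset.Icc 1 (2 * n - 2)) (hpq : p ≠ q)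
    (hpK : p ≠ k + 1) (hqK : q ≠ k + 1) :
    ∑ a, (c p a (m a) - c q a (m a)) = ∑ a, (c p a (m' a) - c q a (m' a)) := by
  have hk : k ∈ Finset.Icc 1 (2 * n - 2) := Finset.mem_Icc.2 ⟨hk1, by omega⟩
  have hK : k + 1 ∈ Finset.Icc 1 (2 * n - 2) := Finset.mem_Icc.2 ⟨by omega, hk2⟩
  obtain ⟨ε, hε, e1, -⟩ := exists_orientation (a := t) (b := j) (a' := t) (b' := j)
    (fun h => htj h.1)
  have e2 : ε j t = false := by rw [hε t j htj, e1, Bool.not_true]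
  obtain ⟨g, hg⟩ := exists_equiv_of_injective (card_color_bool n)
    (u := ![(x, true), (y, true), (κ j t, false)])
    (w := ![(⟨p, hp⟩ : Finset.Icc 1 (2 * n - 2)), ⟨q, hq⟩, ⟨k + 1, hK⟩])
    (by simp [Function.Injective, Fin.forall_fin_succ, hxy, hxy.symm])
    (by simp [Function.Injective, Fin.forall_fin_succ, hpq, hpq.symm, hpK, hpK.symm, hqK,
          hqK.symm])
  simp only [Fin.forall_fin_succ, Matrix.cons_val_zero, Matrix.cons_val_succ] at hg
  obtain ⟨g1, g2, g3, -⟩ := hg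
  refine hκ.sum_eq_of_weight_eq hε hc0 hxy g (by rw [g1]) (by rw [g2]) (fun a b => ?_) hm hmx hm'
    hmy (H _ _ (hκ.isSched g hε) (hκ.isSched _ hε)
      ((hκ.isSched g hε).tight_of_next htj hk (by rw [schedOf, e2, g3]))
      ((hκ.isSched _ hε).tight_of_next htj hk ?_))
  · linarith [asymmetry_const hn heven hk1 hk2 htj H a b hp hq]
  · rw [schedOf, e2, Equiv.trans_apply, Equiv.swap_apply_of_ne_of_ne (g.injective.ne (by simp))
      (g.injective.ne (by simp)), g3]

lemma sum_neighbor_eq_of_color (hn : 4 ≤ n) (heven : Even n) (hk1 : 1 ≤ k)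
    (hk2 : k + 1 ≤ 2 * n - 2) (htj : t ≠ j) (hc0 : ∀ p a, c p a a = 0)
    (H : ∀ τ τ', IsSched n τ → IsSched n τ' → Tight k t j τ → Tight k t j τ' →
      weight c τ = weight c τ')
    (hκ : IsColoring n κ) (hxy : x ≠ y) (hm : ∀ a, m a ≠ a) (hmx : ∀ a, κ a (m a) = x)
    (hm' : ∀ a, m' a ≠ a) (hmy : ∀ a, κ a (m' a) = y) {k' : ℕ}
    (hk' : k' ∈ Finset.Icc 1 (2 * n - 2)) (hk1' : k' ≠ 1) (hkK : k' ≠ k + 1)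
    (hkk : k = 1 ∨ k' = k) (hx : κ j t = x) :
    ∑ a, (c (k + 1) a (m a) - c 1 a (m a)) = ∑ a, (c (k + 1) a (m' a) - c 1 a (m' a)) := by
  have hk : k ∈ Finset.Icc 1 (2 * n - 2) := Finset.mem_Icc.2 ⟨hk1, by omega⟩
  have hK : k + 1 ∈ Finset.Icc 1 (2 * n - 2) := Finset.mem_Icc.2 ⟨by omega, hk2⟩
  have h1 : 1 ∈ Finset.Icc 1 (2 * n - 2) := Finset.mem_Icc.2 ⟨le_rfl, by omega⟩
  obtain ⟨ε, hε, e1, -⟩ := exists_orientation (a := j) (b := t) (a' := j) (b' := t)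
    (fun h => htj h.2)
  have e2 : ε t j = false := by rw [hε j t htj.symm, e1, Bool.not_true]
  have hx' : κ t j = x := by rw [hκ.symm, hx]
  obtain ⟨g, hg⟩ := exists_equiv_of_injective (card_color_bool n)
    (u := ![(x, true), (y, true), (x, false)])
    (w := ![(⟨k + 1, hK⟩ : Finset.Icc 1 (2 * n - 2)), ⟨1, h1⟩, ⟨k', hk'⟩])
    (by simp [Function.Injective, Fin.forall_fin_succ, hxy, hxy.symm])
    (by simp [Function.Injective, Fin.forall_fin_succ, hk1', hk1'.symm, hkK, hkK.symm,
          Nat.ne_of_gt hk1])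
  simp only [Fin.forall_fin_succ, Matrix.cons_val_zero, Matrix.cons_val_succ] at hg
  obtain ⟨g1, g2, g3, -⟩ := hg
  refine hκ.sum_eq_of_weight_eq hε hc0 hxy g (by rw [g1]) (by rw [g2]) (fun a b => ?_) hm hmx hm'
    hmy (H _ _ (hκ.isSched g hε) (hκ.isSched _ hε)
      ((hκ.isSched g hε).tight_of_next htj hk (by rw [schedOf, e1, hx, g1]))
      ((hκ.isSched _ hε).tight_of_first htj hk1 ?_ (hkk.imp id fun e => ⟨j, htj, ?_⟩)))
  · linarith [asymmetry_const hn heven hk1 hk2 htj H a b hK h1]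
  · rw [schedOf, e1, hx, Equiv.trans_apply, Equiv.swap_apply_left, g2]
  · rw [schedOf, e2, hx', Equiv.trans_apply, Equiv.swap_apply_of_ne_of_ne
      (g.injective.ne (by simp)) (g.injective.ne (by simp)), g3]
    exact e

lemma sum_neighbor_eq_next_one (hn : 4 ≤ n) (heven : Even n) (hk1 : 1 ≤ k)
    (hk2 : k + 1 ≤ 2 * n - 2) (htj : t ≠ j) (hc0 : ∀ p a, c p a a = 0)
    (H : ∀ τ τ', IsSched n τ → IsSched n τ' → Tight k t j τ → Tight k t j τ' →
      weight c τ = weight c τ')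
    (hκ : IsColoring n κ) (hxy : x ≠ y) (hm : ∀ a, m a ≠ a) (hmx : ∀ a, κ a (m a) = x)
    (hm' : ∀ a, m' a ≠ a) (hmy : ∀ a, κ a (m' a) = y) :
    ∑ a, (c (k + 1) a (m a) - c 1 a (m a)) = ∑ a, (c (k + 1) a (m' a) - c 1 a (m' a)) := by
  have hk : k ∈ Finset.Icc 1 (2 * n - 2) := Finset.mem_Icc.2 ⟨hk1, by omega⟩
  have hK : k + 1 ∈ Finset.Icc 1 (2 * n - 2) := Finset.mem_Icc.2 ⟨by omega, hk2⟩
  have h1 : 1 ∈ Finset.Icc 1 (2 * n - 2) := Finset.mem_Icc.2 ⟨le_rfl, by omega⟩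
  obtain ⟨k', hk', hk1', hkK, hkk⟩ := exists_home_slot hn hk1 hk2
  by_cases hx : κ j t = x
  · exact sum_neighbor_eq_of_color hn heven hk1 hk2 htj hc0 H hκ hxy hm hmx hm' hmy hk' hk1' hkK
      hkk hx
  by_cases hy : κ j t = y
  · exact (sum_neighbor_eq_of_color hn heven hk1 hk2 htj hc0 H hκ hxy.symm hm' hmy hm hmx hk' hk1'
      hkK hkk hy).symm
  obtain ⟨q, hq, hq'⟩ := exists_slot hn {1, k', k + 1} (Finset.card_le_three.trans (by norm_num))
  simp only [Finset.mem_insert, Finset.mem_singleton, not_or] at hq'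
  obtain ⟨q1, q2, q3⟩ := hq'
  obtain ⟨ε, hε, e1, -⟩ := exists_orientation (a := j) (b := t) (a' := j) (b' := t)
    (fun h => htj h.2)
  have e2 : ε t j = false := by rw [hε j t htj.symm, e1, Bool.not_true]
  obtain ⟨g, hg⟩ := exists_equiv_of_injective (card_color_bool n)
    (u := ![(x, true), (y, true), (κ j t, true), (κ j t, false)])
    (w := ![(⟨k + 1, hK⟩ : Finset.Icc 1 (2 * n - 2)), ⟨q, hq⟩, ⟨1, h1⟩, ⟨k', hk'⟩])
    (by simp [Function.Injective, Fin.forall_fin_succ, hxy, hxy.symm, hx, hy, Ne.symm hx,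
          Ne.symm hy])
    (by simp [Function.Injective, Fin.forall_fin_succ, hk1', hk1'.symm, hkK, hkK.symm,
          Nat.ne_of_gt hk1, q1, q2, q3, Ne.symm q1, Ne.symm q2, Ne.symm q3])
  simp only [Fin.forall_fin_succ, Matrix.cons_val_zero, Matrix.cons_val_succ] at hg
  obtain ⟨g1, g2, g3, g4, -⟩ := hg
  have hrel : ∑ a, (c (k + 1) a (m a) - c q a (m a)) =
      ∑ a, (c (k + 1) a (m' a) - c q a (m' a)) := by
    refine hκ.sum_eq_of_weight_eq hε hc0 hxy g (by rw [g1]) (by rw [g2]) (fun a b => ?_) hm hmx hm'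
      hmy (H _ _ (hκ.isSched g hε) (hκ.isSched _ hε)
        ((hκ.isSched g hε).tight_of_first htj hk1 (by rw [schedOf, e1, g3])
          (hkk.imp id fun e => ⟨j, htj, by rw [schedOf, e2, hκ.symm, g4]; exact e⟩))
        ((hκ.isSched _ hε).tight_of_first htj hk1 ?_ (hkk.imp id fun e => ⟨j, htj, ?_⟩)))
    · linarith [asymmetry_const hn heven hk1 hk2 htj H a b hK hq]
    · rw [schedOf, e1, Equiv.trans_apply, Equiv.swap_apply_of_ne_of_ne
        (g.injective.ne (by simp [hx])) (g.injective.ne (by simp [hy])), g3]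
    · rw [schedOf, e2, hκ.symm, Equiv.trans_apply, Equiv.swap_apply_of_ne_of_ne
        (g.injective.ne (by simp)) (g.injective.ne (by simp)), g4]
      exact e
  have hrel' := sum_neighbor_eq_of_ne hn heven hk1 hk2 htj hc0 H hκ hxy hm hmx hm' hmy hq h1 q1
    q3 (by omega)
  simp only [Finset.sum_sub_distrib] at hrel hrel' ⊢
  linarith

lemma sum_neighbor_eq (hn : 4 ≤ n) (heven : Even n) (hk1 : 1 ≤ k)
    (hk2 : k + 1 ≤ 2 * n - 2) (htj : t ≠ j) (hc0 : ∀ p a, c p a a = 0)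
    (H : ∀ τ τ', IsSched n τ → IsSched n τ' → Tight k t j τ → Tight k t j τ' →
      weight c τ = weight c τ')
    (hκ : IsColoring n κ) (hxy : x ≠ y) (hm : ∀ a, m a ≠ a) (hmx : ∀ a, κ a (m a) = x)
    (hm' : ∀ a, m' a ≠ a) (hmy : ∀ a, κ a (m' a) = y) {p : ℕ}
    (hp : p ∈ Finset.Icc 1 (2 * n - 2)) :
    ∑ a, (c p a (m a) - c 1 a (m a)) = ∑ a, (c p a (m' a) - c 1 a (m' a)) := by
  by_cases hpK : p = k + 1
  · rw [hpK]
    exact sum_neighbor_eq_next_one hn heven hk1 hk2 htj hc0 H hκ hxy hm hmx hm' hmy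
  by_cases hp1 : p = 1
  · simp [hp1]
  · exact sum_neighbor_eq_of_ne hn heven hk1 hk2 htj hc0 H hκ hxy hm hmx hm' hmy hp
      (Finset.mem_Icc.2 ⟨le_rfl, by omega⟩) hp1 hpK (by omega)

/-- Play weights that are constant on tight schedules differ between slots by potentials. -/
lemma exists_slot_potential (hn : 4 ≤ n) (heven : Even n) (hk1 : 1 ≤ k)
    (hk2 : k + 1 ≤ 2 * n - 2) (htj : t ≠ j) (hc0 : ∀ p a, c p a a = 0)
    (H : ∀ τ τ', IsSched n τ → IsSched n τ' → Tight k t j τ → Tight k t j τ' →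
      weight c τ = weight c τ') {p : ℕ} (hp : p ∈ Finset.Icc 1 (2 * n - 2)) :
    ∃ φ : Team n → ℝ, ∀ a b, a ≠ b → c p a b = c 1 a b + φ a + φ b := by
  have h1 : 1 ∈ Finset.Icc 1 (2 * n - 2) := Finset.mem_Icc.2 ⟨le_rfl, by omega⟩
  obtain ⟨κ, hκ⟩ := exists_isColoring hn heven
  have hxy : (⟨0, by omega⟩ : Fin (n - 1)) ≠ ⟨1, by omega⟩ := by simp
  choose m hm hmx using fun a => hκ.exists_neighbor a ⟨0, by omega⟩
  choose m' hm' hmy using fun a => hκ.exists_neighbor a ⟨1, by omega⟩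
  have hδ : ∀ a b, c p a b - c 1 a b = c p b a - c 1 b a := fun a b => by
    linarith [asymmetry_const hn heven hk1 hk2 htj H a b hp h1]
  have hinv : ∀ a, m (m a) = a := fun a => hκ.inj (m a) _ _ (hm _).symm (hm a)
    (by rw [hmx, hκ.symm, hmx])
  have hinv' : ∀ a, m' (m' a) = a := fun a => hκ.inj (m' a) _ _ (hm' _).symm (hm' a)
    (by rw [hmy, hκ.symm, hmy])
  have : Nonempty (Team n) := ⟨t⟩
  obtain ⟨φ, hφ⟩ := exists_potential (by rw [card_team]; omega) hδ
    fun a b c' d => alternating_of_matchings (δ := fun a b => c p a b - c 1 a b) hinv hm hinv' hm'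
      (fun a e => hxy (by rw [← hmx a, ← hmy a, e])) hδ (fun σ => by
        have h2 := sum_neighbor_eq hn heven hk1 hk2 htj hc0 H (hκ.comp σ.symm) hxy
          (m := fun a => σ (m (σ.symm a))) (m' := fun a => σ (m' (σ.symm a)))
          (fun a e => hm (σ.symm a) (by rw [← σ.symm_apply_apply (m _), e]))
          (fun a => by rw [σ.symm_apply_apply, hmx])
          (fun a e => hm' (σ.symm a) (by rw [← σ.symm_apply_apply (m' _), e]))
          (fun a => by rw [σ.symm_apply_apply, hmy]) hp
        rw [← Equiv.sum_comp σ,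
          ← Equiv.sum_comp σ fun a => c p a (σ (m' (σ.symm a))) - c 1 a (σ (m' (σ.symm a)))] at h2
        simpa only [σ.symm_apply_apply] using h2)
  refine ⟨φ, fun a b hab => ?_⟩
  linarith [hφ a b hab]

lemma weight_eq_of_slot_potential {τ τ' : Team n → Team n → ℕ} {φ : ℕ → Team n → ℝ}
    (hc0 : ∀ p a, c p a a = 0)
    (hφ : ∀ p ∈ Finset.Icc 1 (2 * n - 2), ∀ a b, a ≠ b → c p a b = c 1 a b + φ p a + φ p b)
    (hτ : IsSched n τ) (hτ' : IsSched n τ') : weight c τ = weight c τ' := by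
  suffices h : ∀ τ, IsSched n τ → weight c τ = ∑ a, ∑ b ∈ Finset.univ.filter (· ≠ a), c 1 a b +
      ∑ a, ∑ p ∈ Finset.Icc 1 (2 * n - 2), φ p a by
    rw [h τ hτ, h τ' hτ']
  intro τ hτ
  have h1 : weight c τ = ∑ a, ∑ b ∈ Finset.univ.filter (· ≠ a), c (τ a b) a b := by
    rw [weight, Fintype.sum_prod_type]
    refine Finset.sum_congr rfl fun a _ => ?_
    rw [Finset.sum_filter_of_ne]
    rintro b - h rfl
    exact h (hc0 _ _)
  have h2 : ∀ f : Team n → Team n → ℝ, ∑ a, ∑ b ∈ Finset.univ.filter (· ≠ a), f a b =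
      ∑ a, ∑ b ∈ Finset.univ.filter (· ≠ a), f b a := by
    intro f
    refine Finset.sum_comm' ?_
    intro a b
    simp [eq_comm]
  have h3 : ∀ a, ∑ b ∈ Finset.univ.filter (· ≠ a), c (τ a b) a b =
      ∑ b ∈ Finset.univ.filter (· ≠ a), (c 1 a b + φ (τ a b) a + φ (τ a b) b) := by
    intro a
    refine Finset.sum_congr rfl fun b hb => ?_
    have hab := (Finset.mem_filter.1 hb).2.symm
    exact hφ _ (hτ.mem a b hab) a b hab
  rw [h1, Finset.sum_congr rfl fun a _ => h3 a]
  simp only [Finset.sum_add_distrib]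
  rw [h2 fun a b => φ (τ a b) b, add_assoc, ← Finset.sum_add_distrib]
  congr 1
  refine Finset.sum_congr rfl fun a _ => ?_
  rw [← Finset.sum_add_distrib]
  exact hτ.sum_eq a fun p => φ p a

lemma weight_const (hn : 4 ≤ n) (heven : Even n) (hk1 : 1 ≤ k)
    (hk2 : k + 1 ≤ 2 * n - 2) (htj : t ≠ j) (hc0 : ∀ p a, c p a a = 0)
    (H : ∀ τ τ', IsSched n τ → IsSched n τ' → Tight k t j τ → Tight k t j τ' →
      weight c τ = weight c τ') {τ τ' : Team n → Team n → ℕ}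
    (hτ : IsSched n τ) (hτ' : IsSched n τ') : weight c τ = weight c τ' := by
  have h : ∀ p : ℕ, ∃ φ : Team n → ℝ, p ∈ Finset.Icc 1 (2 * n - 2) →
      ∀ a b, a ≠ b → c p a b = c 1 a b + φ a + φ b := by
    intro p
    by_cases hp : p ∈ Finset.Icc 1 (2 * n - 2)
    · obtain ⟨φ, hφ⟩ := exists_slot_potential hn heven hk1 hk2 htj hc0 H hp
      exact ⟨φ, fun _ => hφ⟩
    · exact ⟨0, fun h => absurd h hp⟩
  choose φ hφ using h
  exact weight_eq_of_slot_potential hc0 hφ hτ hτ'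

end Potential

section Travel

variable {n : ℕ} {k : ℕ} {t j : Team n}

lemma exists_sched_away_away (hn : 4 ≤ n) (heven : Even n) (htj : t ≠ j) {u v : Team n}
    (huv : u ≠ v) (hne : ¬(u = t ∧ v = j)) {r q s : ℕ} (hr : r ∈ Finset.Icc 1 (2 * n - 2))
    (hq : q ∈ Finset.Icc 1 (2 * n - 2)) (hs : s ∈ Finset.Icc 1 (2 * n - 2)) (hqr : q ≠ r)
    (hsr : s ≠ r) (hqs : q ≠ s) :
    ∃ τ, IsSched n τ ∧ τ j t = r ∧ τ v u = q ∧ AwayAt τ u s := by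
  suffices h : ∃ τ, IsSched n τ ∧ τ j t = r ∧ τ v u = q ∧ τ t j ≠ s ∧ τ u v ≠ s by
    obtain ⟨τ₀, e1, e2, e3, e4, e5⟩ := h
    obtain ⟨τ, f1, f2, f3⟩ := e1.exists_awayAt u hs
    exact ⟨τ, f1, (f3 j t (by omega) e4).trans e2, (f3 v u (by omega) e5).trans e3, f2⟩
  obtain ⟨x, hx, hx'⟩ := exists_slot hn {r, q, s} (Finset.card_le_three.trans (by norm_num))
  simp only [Finset.mem_insert, Finset.mem_singleton, not_or] at hx'
  obtain ⟨y, hy, hy'⟩ := exists_slot hn {r, q, s, x} (Finset.card_le_four.trans (by norm_num))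
  simp only [Finset.mem_insert, Finset.mem_singleton, not_or] at hy'
  by_cases hu : u = t ∨ u = j
  · by_cases hv : v = t ∨ v = j
    · obtain ⟨rfl, rfl⟩ : u = j ∧ v = t := by grind
      obtain ⟨τ, e1, e2, e3⟩ := exists_sched_pair hn heven htj.symm hr hq hqr.symm
      exact ⟨τ, e1, e2, e3, by omega, by omega⟩
    · push Not at hv
      obtain ⟨τ, e1, e2, e3, e4, e5⟩ := exists_sched_meeting hn heven htj hu hv.1 hv.2 hx hq hr hy
        (by omega) (by omega) (by omega) (by omega) (by omega) (by omega)
      exact ⟨τ, e1, e4, e3, by omega, by omega⟩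
  · push Not at hu
    by_cases hv : v = t ∨ v = j
    · obtain ⟨τ, e1, e2, e3, e4, e5⟩ := exists_sched_meeting hn heven htj hv hu.1 hu.2 hq hx hr hy
        (by omega) (by omega) (by omega) (by omega) (by omega) (by omega)
      exact ⟨τ, e1, e4, e2, by omega, by omega⟩
    · push Not at hv
      obtain ⟨τ, e1, e2, e3, e4, e5⟩ := exists_sched_disjoint hn heven huv hu.2 hu.1 hv.2 hv.1
        htj.symm hr hq hqr.symm
      exact ⟨τ, e1, e4, e3, by omega, by omega⟩

lemma exists_consecutive_slots {n K : ℕ} (hn : 4 ≤ n) :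
    ∃ l, l ∈ Finset.Icc 1 (2 * n - 2) ∧ l + 1 ∈ Finset.Icc 1 (2 * n - 2) ∧ l ≠ K ∧ l + 1 ≠ K := by
  simp only [Finset.mem_Icc]
  by_cases h : K ≤ 2
  · exact ⟨3, by omega, by omega, by omega, by omega⟩
  · exact ⟨1, by omega, by omega, by omega, by omega⟩

lemma exists_tight_travel_away_home_eq_zero (hn : 4 ≤ n) (heven : Even n) (hk1 : 1 ≤ k)
    (hk2 : k + 1 ≤ 2 * n - 2) (htj : t ≠ j) :
    ∃ τ, IsSched n τ ∧ Tight k t j τ ∧ travel n (matchSet τ) (t, j, t) = 0 := by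
  have hk : k ∈ Finset.Icc 1 (2 * n - 2) := Finset.mem_Icc.2 ⟨hk1, by omega⟩
  have hK : k + 1 ∈ Finset.Icc 1 (2 * n - 2) := Finset.mem_Icc.2 ⟨by omega, hk2⟩
  by_cases hlast : k + 1 = 2 * n - 2
  · obtain ⟨τ₀, e1, e2, e3⟩ := exists_sched_pair hn heven htj.symm (p := 1) (q := k)
      (Finset.mem_Icc.2 ⟨le_rfl, by omega⟩) hk (by omega)
    obtain ⟨τ, f1, f2, f3⟩ := e1.exists_awayAt t (r := 2) (Finset.mem_Icc.2 ⟨by omega, by omega⟩)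
    have g1 := (f3 j t (by omega) (by omega)).trans e2
    have g2 := (f3 t j (by omega) (by omega)).trans e3
    exact ⟨τ, f1, f1.tight_of_first htj hk1 g1 (Or.inr ⟨j, htj, g2⟩),
      f1.travel_away_home_eq_zero htj g1 f2⟩
  · obtain ⟨r, hr, hr'⟩ := exists_slot hn {k + 1, k + 1 + 1}
      (Finset.card_le_two.trans (by norm_num))
    simp only [Finset.mem_insert, Finset.mem_singleton, not_or] at hr'
    obtain ⟨τ₀, e1, e2, e3⟩ := exists_sched_pair hn heven htj.symm hK hr (Ne.symm hr'.1)
    obtain ⟨τ, f1, f2, f3⟩ := e1.exists_awayAt t (r := k + 1 + 1)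
      (Finset.mem_Icc.2 ⟨by omega, by omega⟩)
    have g1 := (f3 j t (by omega) (by omega)).trans e2
    exact ⟨τ, f1, f1.tight_of_next htj hk g1, f1.travel_away_home_eq_zero htj g1 f2⟩

lemma exists_tight_travel_away_away_eq_zero (hn : 4 ≤ n) (heven : Even n) (hk1 : 1 ≤ k)
    (hk2 : k + 1 ≤ 2 * n - 2) (htj : t ≠ j) {u a b : Team n} (hua : u ≠ a) (hub : u ≠ b)
    (hab : a ≠ b) :
    ∃ τ, IsSched n τ ∧ Tight k t j τ ∧ travel n (matchSet τ) (u, a, b) = 0 := by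
  have hk : k ∈ Finset.Icc 1 (2 * n - 2) := Finset.mem_Icc.2 ⟨hk1, by omega⟩
  have hK : k + 1 ∈ Finset.Icc 1 (2 * n - 2) := Finset.mem_Icc.2 ⟨by omega, hk2⟩
  obtain ⟨τ, e1, e2, -⟩ := exists_sched_pair hn heven htj.symm hK hk (by omega)
  by_cases hc : τ b u = τ a u + 1
  · have h1 := e1.home_ne_away u a a hua hua
    have h2 := e1.home_ne_away u b b hub hub
    by_cases hau : (j = a ∧ t = u) ∨ (j = u ∧ t = a)
    · refine ⟨flip τ b u, e1.flip b u, (e1.flip b u).tight_of_next htj hk ?_,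
        travel_away_away_eq_zero hua hub ?_⟩
      · rw [flip_of_ne (by grind) (by grind), e2]
      · rw [flip_left, flip_of_ne (fun h => hab h.1) (fun h => hua h.1.symm)]
        omega
    · rw [not_or] at hau
      refine ⟨flip τ a u, e1.flip a u, (e1.flip a u).tight_of_next htj hk ?_,
        travel_away_away_eq_zero hua hub ?_⟩
      · rw [flip_of_ne hau.1 hau.2, e2]
      · rw [flip_left, flip_of_ne (fun h => hab h.1.symm) (fun h => hub h.1.symm)]
        omega
  · exact ⟨τ, e1, e1.tight_of_next htj hk e2, travel_away_away_eq_zero hua hub hc⟩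

/-- Every travel variable other than `y_{t,t,j}` is free at some tight schedule. -/
lemma exists_tight_travel_eq_zero (hn : 4 ≤ n) (heven : Even n) (hk1 : 1 ≤ k)
    (hk2 : k + 1 ≤ 2 * n - 2) (htj : t ≠ j) {u a b : Team n} (hab : a ≠ b)
    (hne : ¬(u = t ∧ a = t ∧ b = j)) :
    ∃ τ, IsSched n τ ∧ Tight k t j τ ∧ travel n (matchSet τ) (u, a, b) = 0 := by
  have hk : k ∈ Finset.Icc 1 (2 * n - 2) := Finset.mem_Icc.2 ⟨hk1, by omega⟩
  have hK : k + 1 ∈ Finset.Icc 1 (2 * n - 2) := Finset.mem_Icc.2 ⟨by omega, hk2⟩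
  obtain ⟨l, hl, hl', hlK, hlK'⟩ := exists_consecutive_slots (K := k + 1) hn
  by_cases hua : u = a
  · subst hua
    obtain ⟨τ, e1, e2, e3, e4⟩ := exists_sched_away_away hn heven htj hab
      (fun h => hne ⟨h.1, h.1, h.2⟩) hK hl' hl hlK' hlK (by omega)
    exact ⟨τ, e1, e1.tight_of_next htj hk e2, e1.travel_home_away_eq_zero hab e3 e4⟩
  by_cases hub : u = b
  · subst hub
    by_cases hutj : u = t ∧ a = j
    · obtain ⟨rfl, rfl⟩ := hutj
      exact exists_tight_travel_away_home_eq_zero hn heven hk1 hk2 htj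
    · obtain ⟨τ, e1, e2, e3, e4⟩ := exists_sched_away_away hn heven htj hua hutj hK hl hl' hlK
        hlK' (by omega)
      exact ⟨τ, e1, e1.tight_of_next htj hk e2, e1.travel_away_home_eq_zero hua e3 e4⟩
  exact exists_tight_travel_away_away_eq_zero hn heven hk1 hk2 htj hua hub hab

lemma exists_travel_eq_zero (hn : 4 ≤ n) (heven : Even n) (htj : t ≠ j) :
    ∃ τ, IsSched n τ ∧ travel n (matchSet τ) (t, t, j) = 0 := by
  obtain ⟨τ₀, e1, e2, e3⟩ := exists_sched_pair hn heven htj.symm (p := 2) (q := 3)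
    (Finset.mem_Icc.2 ⟨by omega, by omega⟩) (Finset.mem_Icc.2 ⟨by omega, by omega⟩) (by omega)
  obtain ⟨τ, f1, f2, f3⟩ := e1.exists_awayAt t (r := 1) (Finset.mem_Icc.2 ⟨by omega, by omega⟩)
  exact ⟨τ, f1, f1.travel_home_away_eq_zero htj
    ((f3 j t (by omega) (by omega)).trans e2) f2⟩

end Travel

section Facet

/-- A face of a polytope has codimension one if every linear functional that is constant on the
vertices of the face and vanishes on a direction `v` transversal to it is constant on all
vertices. -/
lemma finrank_face_add_one {E : Type*} [AddCommGroup E] [Module ℝ E] [Module.Finite ℝ E]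
    {G : Set E} (f : E →ₗ[ℝ] ℝ) {γ : ℝ} {v : E} (hfv : f v ≠ 0) (hv : v ∈ vectorSpan ℝ G)
    (hG : ∀ g : E →ₗ[ℝ] ℝ, g v = 0 →
      (∀ z ∈ G, ∀ z' ∈ G, f z = γ → f z' = γ → g z = g z') → ∀ z ∈ G, ∀ z' ∈ G, g z = g z') :
    Module.finrank ℝ (affineSpan ℝ {z ∈ convexHull ℝ G | f z = γ}).direction + 1 =
      Module.finrank ℝ (affineSpan ℝ (convexHull ℝ G)).direction := by
  have key : ∀ (h : E →ₗ[ℝ] ℝ) (s : Set E), vectorSpan ℝ s ≤ LinearMap.ker h ↔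
      ∀ z ∈ s, ∀ z' ∈ s, h z = h z' := by
    intro h s
    rw [vectorSpan_def, Submodule.span_le]
    constructor
    · intro h1 z hz z' hz'
      simpa [sub_eq_zero] using h1 (Set.vsub_mem_vsub hz hz')
    · rintro h1 _ ⟨z, hz, z', hz', rfl⟩
      simpa [sub_eq_zero] using h1 z hz z' hz'
  rw [affineSpan_convexHull, direction_affineSpan, direction_affineSpan]
  set D := vectorSpan ℝ {z ∈ convexHull ℝ G | f z = γ} with hD
  have hvD : v ∉ D := fun h => hfv
    (((key f {z ∈ convexHull ℝ G | f z = γ}).2 fun z hz z' hz' => hz.2.trans hz'.2.symm) h)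
  have hDG : D ≤ vectorSpan ℝ G := by
    rw [← direction_affineSpan ℝ G, ← affineSpan_convexHull, direction_affineSpan]
    exact vectorSpan_mono ℝ fun z hz => hz.1
  rw [← Submodule.finrank_sup_span_singleton hvD]
  suffices h : D ⊔ Submodule.span ℝ {v} = vectorSpan ℝ G by rw [h]
  refine le_antisymm (sup_le hDG (by simpa using hv)) fun w hw => ?_
  by_contra hw'
  obtain ⟨g, hgw, hg⟩ := Submodule.exists_le_ker_of_notMem hw'
  rw [sup_le_iff] at hg
  refine hgw ((key g G).2 (hG g (hg.2 (Submodule.mem_span_singleton_self v)) ?_) hw)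
  intro z hz z' hz' h1 h2
  exact (key g _).1 hg.1 z ⟨subset_convexHull ℝ G hz, h1⟩ z' ⟨subset_convexHull ℝ G hz', h2⟩

variable {n : ℕ}

lemma finite_triple (n N : ℕ) (P : ℕ × ℕ × ℕ → Prop)
    (h : ∀ m, P m → m.1 ≤ N ∧ m.2.1 ≤ n ∧ m.2.2 ≤ n) : Finite {m // P m} := by
  refine Set.Finite.subset
    (Finset.finite_toSet (Finset.range (N + 1) ×ˢ Finset.range (n + 1) ×ˢ Finset.range (n + 1)))
    fun m hm => ?_
  have := h m hm
  simp only [Finset.coe_product, Set.mem_prod, Finset.coe_range, Set.mem_Iio]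
  omega

instance (n : ℕ) : Finite {m : ℕ × ℕ × ℕ // IsMatch n m} :=
  finite_triple n (2 * n - 2) _ fun _ h => ⟨h.2.1, h.2.2.2.1, h.2.2.2.2.2.1⟩

instance (n : ℕ) : Finite {p : ℕ × ℕ × ℕ // IsTravelIdx n p} :=
  finite_triple n n _ fun _ h => ⟨h.2.1, h.2.2.2.1, h.2.2.2.2.2.1⟩

lemma xval_add (z w : Pt n) (p i j : ℕ) : xval (z + w) p i j = xval z p i j + xval w p i j := by
  unfold xval
  split_ifs <;> simp

lemma xval_smul (r : ℝ) (z : Pt n) (p i j : ℕ) : xval (r • z) p i j = r * xval z p i j := by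
  unfold xval
  split_ifs <;> simp

lemma yval_add (z w : Pt n) (t i j : ℕ) : yval (z + w) t i j = yval z t i j + yval w t i j := by
  unfold yval
  split_ifs <;> simp

lemma yval_smul (r : ℝ) (z : Pt n) (t i j : ℕ) : yval (r • z) t i j = r * yval z t i j := by
  unfold yval
  split_ifs <;> simp

/-- The left-hand side of the lifted home-away inequality. -/
noncomputable def liftedForm (n k t j : ℕ) : Pt n →ₗ[ℝ] ℝ :=
  IsLinearMap.mk' (fun z : Pt n => xval z 1 j t + xval z k j t +
      (∑ i ∈ Finset.Icc 1 n \ {t}, xval z k t i) + xval z (k + 1) j t - yval z t t j)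
    { map_add := fun z w => by
        simp only [xval_add, yval_add, Finset.sum_add_distrib]
        ring
      map_smul := fun r z => by
        simp only [xval_smul, yval_smul, ← Finset.mul_sum, smul_eq_mul]
        ring }

lemma isMatch_team {a b : Team n} (hab : a ≠ b) {p : ℕ} (hp : p ∈ Finset.Icc 1 (2 * n - 2)) :
    IsMatch n (p, a.1, b.1) := by
  have h1 := Finset.mem_Icc.1 hp
  have h2 := Finset.mem_Icc.1 a.2
  have h3 := Finset.mem_Icc.1 b.2
  exact ⟨h1.1, h1.2, h2.1, h2.2, h3.1, h3.2, Subtype.coe_ne_coe.2 hab⟩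

lemma isTravelIdx_team (u : Team n) {a b : Team n} (hab : a ≠ b) :
    IsTravelIdx n (u.1, a.1, b.1) := by
  have h1 := Finset.mem_Icc.1 u.2
  have h2 := Finset.mem_Icc.1 a.2
  have h3 := Finset.mem_Icc.1 b.2
  exact ⟨h1.1, h1.2, h2.1, h2.2, h3.1, h3.2, Subtype.coe_ne_coe.2 hab⟩

/-- The play vector of the tournament of `τ`, as a point of `ℝ^M`. -/
noncomputable def playVec (n : ℕ) (τ : Team n → Team n → ℕ)
    (m : {m : ℕ × ℕ × ℕ // IsMatch n m}) : ℝ :=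
  play (matchSet τ) m.1

lemma xval_playVec {τ : Team n → Team n → ℕ} {a b : Team n} (hab : a ≠ b) {p : ℕ}
    (hp : p ∈ Finset.Icc 1 (2 * n - 2)) (y : {p : ℕ × ℕ × ℕ // IsTravelIdx n p} → ℝ) :
    xval (playVec n τ, y) p a b = if τ a b = p then 1 else 0 := by
  rw [xval, dif_pos (isMatch_team hab hp)]
  simp only [playVec, play, mem_matchSet, hab, ne_eq, not_false_eq_true, true_and]

lemma IsSched.sum_xval_playVec {τ : Team n → Team n → ℕ} (h : IsSched n τ) (t : Team n) {p : ℕ}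
    (hp : p ∈ Finset.Icc 1 (2 * n - 2)) (y : {p : ℕ × ℕ × ℕ // IsTravelIdx n p} → ℝ) :
    ∑ i ∈ Finset.Icc 1 n \ {t.1}, xval (playVec n τ, y) p t i =
      if HomeAt τ t p then 1 else 0 := by
  have hx : ∀ i ∈ Finset.Icc 1 n \ {t.1}, ∃ v : Team n, v.1 = i ∧ t ≠ v := by
    intro i hi
    rw [Finset.mem_sdiff, Finset.mem_singleton] at hi
    exact ⟨⟨i, hi.1⟩, rfl, fun e => hi.2 (congrArg Subtype.val e).symm⟩
  split_ifs with hh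
  · obtain ⟨v, hv, hv'⟩ := hh
    rw [Finset.sum_eq_single v.1]
    · rw [xval_playVec hv hp, if_pos hv']
    · intro i hi hiv
      obtain ⟨w, rfl, hw⟩ := hx i hi
      rw [xval_playVec hw hp, if_neg]
      exact fun e => hiv (congrArg Subtype.val (h.home_inj t w v hw hv (e.trans hv'.symm)))
    · intro hn
      rw [Finset.mem_sdiff, Finset.mem_singleton] at hn
      exact absurd ⟨v.2, Subtype.coe_ne_coe.2 hv.symm⟩ hn
  · refine Finset.sum_eq_zero fun i hi => ?_
    obtain ⟨w, rfl, hw⟩ := hx i hi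
    rw [xval_playVec hw hp, if_neg]
    exact fun e => hh ⟨w, hw, e⟩

lemma IsSched.liftedForm_apply {τ : Team n → Team n → ℕ} (h : IsSched n τ) {k : ℕ}
    {t j : Team n} (htj : t ≠ j) (hk1 : 1 ≤ k) (hk2 : k + 1 ≤ 2 * n - 2)
    (y : {p : ℕ × ℕ × ℕ // IsTravelIdx n p} → ℝ) :
    liftedForm n k t j (playVec n τ, y) =
      (if τ j t = 1 then (1 : ℝ) else 0) + (if τ j t = k then 1 else 0) +
      (if HomeAt τ t k then 1 else 0) + (if τ j t = k + 1 then 1 else 0) -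
        y ⟨(t, t, j), isTravelIdx_team t htj⟩ := by
  have hk : k ∈ Finset.Icc 1 (2 * n - 2) := Finset.mem_Icc.2 ⟨hk1, by omega⟩
  have hK : k + 1 ∈ Finset.Icc 1 (2 * n - 2) := Finset.mem_Icc.2 ⟨by omega, hk2⟩
  have h1 : 1 ∈ Finset.Icc 1 (2 * n - 2) := Finset.mem_Icc.2 ⟨le_rfl, by omega⟩
  simp only [liftedForm, IsLinearMap.mk'_apply]
  rw [xval_playVec htj.symm h1, xval_playVec htj.symm hk, xval_playVec htj.symm hK,
    h.sum_xval_playVec t hk, yval, dif_pos (isTravelIdx_team t htj)]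

/-- The points whose convex hull is `Ptt n`. -/
def generators (n : ℕ) : Set (Pt n) :=
  {z | ∃ τ, IsSched n τ ∧ z.1 = playVec n τ ∧ (∀ p, z.2 p = 0 ∨ z.2 p = 1) ∧
    ∀ p, travel n (matchSet τ) p.1 ≤ z.2 p}

lemma ptt_eq_convexHull (n : ℕ) : Ptt n = convexHull ℝ (generators n) := by
  rw [Ptt]
  congr 1
  ext z
  constructor
  · rintro ⟨T, hT, h1, h2, h3⟩
    obtain ⟨τ, hτ, rfl⟩ := hT.exists_sched
    exact ⟨τ, hτ, funext h1, h2, h3⟩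
  · rintro ⟨τ, hτ, h1, h2, h3⟩
    exact ⟨matchSet τ, hτ.isTournament, fun m => by rw [h1]; rfl, h2, h3⟩

/-- The travel vector that is minimal on the indices in `S` and `1` elsewhere. -/
noncomputable def travelVec (τ : Team n → Team n → ℕ)
    (S : Set {p : ℕ × ℕ × ℕ // IsTravelIdx n p}) (p : {p : ℕ × ℕ × ℕ // IsTravelIdx n p}) : ℝ :=
  if p ∈ S then travel n (matchSet τ) p.1 else 1

lemma IsSched.mem_generators {τ : Team n → Team n → ℕ} (h : IsSched n τ)
    (S : Set {p : ℕ × ℕ × ℕ // IsTravelIdx n p}) :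
    ((playVec n τ, travelVec τ S) : Pt n) ∈ generators n := by
  refine ⟨τ, h, rfl, fun p => ?_, fun p => ?_⟩
  · simp only [travelVec]
    split_ifs
    · exact travel_eq_zero_or_one _ _ _
    · exact Or.inr rfl
  · simp only [travelVec]
    split_ifs
    · exact le_rfl
    · rcases travel_eq_zero_or_one n (matchSet τ) p.1 with e | e <;> norm_num [e]

/-- The coordinate direction of a travel index. -/
noncomputable def travelDir (e : {p : ℕ × ℕ × ℕ // IsTravelIdx n p}) : Pt n :=
  (0, fun p => if e = p then 1 else 0)

lemma sub_eq_travelDir {τ : Team n → Team n → ℕ} {S : Set {p : ℕ × ℕ × ℕ // IsTravelIdx n p}}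
    {e : {p : ℕ × ℕ × ℕ // IsTravelIdx n p}} (heS : e ∉ S)
    (he : travel n (matchSet τ) e.1 = 0) :
    ((playVec n τ, travelVec τ S) : Pt n) - (playVec n τ, travelVec τ (insert e S)) =
      travelDir e := by
  refine Prod.ext (sub_self _) (funext fun p => ?_)
  simp only [travelDir, travelVec, Prod.snd_sub, Pi.sub_apply, Set.mem_insert_iff]
  by_cases hp : e = p
  · subst hp
    simp [heS, he]
  · simp [hp, Ne.symm hp]

lemma linear_eq_of_travelDir {g : Pt n →ₗ[ℝ] ℝ} (h : ∀ e, g (travelDir e) = 0) (z : Pt n) :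
    g z = g (z.1, 0) := by
  have := Fintype.ofFinite {p : ℕ × ℕ × ℕ // IsTravelIdx n p}
  have h1 : g (0, z.2) = 0 := by
    have h2 := (g ∘ₗ LinearMap.inr ℝ _ _).pi_apply_eq_sum_univ z.2
    simp only [LinearMap.comp_apply, LinearMap.inr_apply] at h2
    rw [h2]
    exact Finset.sum_eq_zero fun e _ => by rw [← travelDir, h e, smul_zero]
  have h3 : z = (z.1, 0) + (0, z.2) := by simp
  nth_rewrite 1 [h3]
  rw [map_add, h1, add_zero]

/-- The coefficients of a linear functional on the play coordinates. -/
noncomputable def playCoeff (g : Pt n →ₗ[ℝ] ℝ) (p : ℕ) (a b : Team n) : ℝ :=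
  if h : IsMatch n (p, a.1, b.1) then
    g ((fun m => if (⟨(p, a.1, b.1), h⟩ : {m : ℕ × ℕ × ℕ // IsMatch n m}) = m then 1 else 0), 0)
  else 0

lemma playCoeff_self (g : Pt n →ₗ[ℝ] ℝ) (p : ℕ) (a : Team n) : playCoeff g p a a = 0 :=
  dif_neg fun h => h.2.2.2.2.2.2 rfl

lemma IsSched.linear_playVec {τ : Team n → Team n → ℕ} (h : IsSched n τ) (g : Pt n →ₗ[ℝ] ℝ) :
    g (playVec n τ, 0) = weight (playCoeff g) τ := by
  have := Fintype.ofFinite {m : ℕ × ℕ × ℕ // IsMatch n m}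
  have h2 := (g ∘ₗ LinearMap.inl ℝ _ _).pi_apply_eq_sum_univ (playVec n τ)
  simp only [LinearMap.comp_apply, LinearMap.inl_apply] at h2
  rw [h2, weight]
  let e : {p : Team n × Team n // p.1 ≠ p.2} → {m : ℕ × ℕ × ℕ // IsMatch n m} :=
    fun p => ⟨(τ p.1.1 p.1.2, p.1.1.1, p.1.2.1), isMatch_team p.2 (h.mem _ _ p.2)⟩
  have he : Function.Injective e := by
    rintro ⟨⟨a, b⟩, hab⟩ ⟨⟨a', b'⟩, hab'⟩ hee
    have := congrArg Subtype.val hee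
    simp only [e, Prod.mk.injEq] at this
    exact Subtype.ext (Prod.ext (Subtype.ext this.2.1) (Subtype.ext this.2.2))
  rw [← Fintype.sum_of_injective e he (fun p => playCoeff g (τ p.1.1 p.1.2) p.1.1 p.1.2),
    Fintype.sum_of_injective Subtype.val Subtype.val_injective _
      (fun p : Team n × Team n => playCoeff g (τ p.1 p.2) p.1 p.2) _ (fun _ => rfl)]
  · rintro ⟨a, b⟩ hp
    obtain rfl : a = b := by
      by_contra hab
      exact hp ⟨⟨(a, b), hab⟩, rfl⟩
    exact playCoeff_self g _ a
  · rintro ⟨_, hm⟩ hp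
    rw [playVec, play, if_neg, zero_smul]
    rintro ⟨a, b, hab, rfl⟩
    exact hp ⟨⟨(a, b), hab⟩, rfl⟩
  · rintro ⟨⟨a, b⟩, hab⟩
    have hp : playVec n τ (e ⟨(a, b), hab⟩) = 1 := if_pos ⟨a, b, hab, rfl⟩
    rw [hp, one_smul, playCoeff, dif_pos (isMatch_team hab (h.mem a b hab))]

lemma liftedForm_le {k : ℕ} {t j : Team n} (htj : t ≠ j) (hk1 : 1 ≤ k)
    (hk2 : k + 1 ≤ 2 * n - 2) {z : Pt n} (hz : z ∈ Ptt n) : liftedForm n k t j z ≤ 1 := by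
  rw [ptt_eq_convexHull] at hz
  refine convexHull_min ?_ (convex_halfSpace_le (liftedForm n k t j).isLinear 1) hz
  rintro ⟨x, y⟩ ⟨τ, hτ, rfl, -, h3⟩
  have h1 := hτ.lifted_le hk1 htj
  have h2 := h3 ⟨(t, t, j), isTravelIdx_team t htj⟩
  simp only [Set.mem_ofPred_eq, hτ.liftedForm_apply htj hk1 hk2] at h2 ⊢
  linarith

lemma Tight.liftedForm_eq {k : ℕ} {t j : Team n} {τ : Team n → Team n → ℕ} (h : IsSched n τ)
    (ht : Tight k t j τ) (htj : t ≠ j) (hk1 : 1 ≤ k) (hk2 : k + 1 ≤ 2 * n - 2)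
    {S : Set {p : ℕ × ℕ × ℕ // IsTravelIdx n p}}
    (hS : ⟨(t, t, j), isTravelIdx_team t htj⟩ ∈ S) :
    liftedForm n k t j (playVec n τ, travelVec τ S) = 1 := by
  rw [h.liftedForm_apply htj hk1 hk2, travelVec, if_pos hS]
  exact ht

lemma adim_face_add_one (hn : 4 ≤ n) (heven : Even n) {k : ℕ} {t j : Team n} (htj : t ≠ j)
    (hk1 : 1 ≤ k) (hk2 : k + 1 ≤ 2 * n - 2) :
    adim {z ∈ Ptt n | liftedForm n k t j z = 1} + 1 = adim (Ptt n) := by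
  set e₀ : {p : ℕ × ℕ × ℕ // IsTravelIdx n p} := ⟨(t, t, j), isTravelIdx_team t htj⟩ with he₀
  rw [ptt_eq_convexHull]
  refine finrank_face_add_one (liftedForm n k t j) (v := travelDir e₀) ?_ ?_ ?_
  · have h1 : ∀ p a b, xval (travelDir e₀) p a b = 0 := by
      intro p a b
      unfold xval
      split_ifs <;> rfl
    have h2 : yval (travelDir e₀) t t j = 1 := by
      rw [yval, dif_pos (isTravelIdx_team t htj)]
      simp [travelDir, he₀]
    simp [liftedForm, h1, h2]
  · obtain ⟨τ, hτ, h1⟩ := exists_travel_eq_zero hn heven htj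
    rw [← sub_eq_travelDir (Set.notMem_empty e₀) h1]
    exact vsub_mem_vectorSpan ℝ (hτ.mem_generators _) (hτ.mem_generators _)
  · intro g hg0 hg
    have hdir : ∀ e, g (travelDir e) = 0 := by
      intro e
      by_cases hee : e = e₀
      · rw [hee, hg0]
      obtain ⟨⟨u, a, b⟩, he⟩ := e
      have he' := he
      simp only [IsTravelIdx] at he'
      obtain ⟨τ, hτ, h1, h2⟩ := exists_tight_travel_eq_zero hn heven hk1 hk2 htj
        (u := ⟨u, Finset.mem_Icc.2 ⟨he'.1, he'.2.1⟩⟩)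
        (a := ⟨a, Finset.mem_Icc.2 ⟨he'.2.2.1, he'.2.2.2.1⟩⟩)
        (b := ⟨b, Finset.mem_Icc.2 ⟨he'.2.2.2.2.1, he'.2.2.2.2.2.1⟩⟩)
        (fun h => he'.2.2.2.2.2.2 (congrArg Subtype.val h))
        (fun ⟨h1, h2, h3⟩ => hee (Subtype.ext (Prod.ext (congrArg Subtype.val h1)
          (Prod.ext (congrArg Subtype.val h2) (congrArg Subtype.val h3)))))
      rw [← sub_eq_travelDir (S := {e₀}) hee h2, map_sub, sub_eq_zero]
      exact hg _ (hτ.mem_generators _) _ (hτ.mem_generators _)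
        (h1.liftedForm_eq hτ htj hk1 hk2 rfl)
        (h1.liftedForm_eq hτ htj hk1 hk2 (Set.mem_insert_of_mem _ rfl))
    have H : ∀ τ τ', IsSched n τ → IsSched n τ' → Tight k t j τ → Tight k t j τ' →
        weight (playCoeff g) τ = weight (playCoeff g) τ' := by
      intro τ τ' h1 h2 h3 h4
      have h5 := hg _ (h1.mem_generators {e₀}) _ (h2.mem_generators {e₀})
        (h3.liftedForm_eq h1 htj hk1 hk2 rfl) (h4.liftedForm_eq h2 htj hk1 hk2 rfl)
      rw [linear_eq_of_travelDir hdir, linear_eq_of_travelDir hdir (playVec n τ', _)] at h5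
      rwa [h1.linear_playVec, h2.linear_playVec] at h5
    rintro ⟨x, y⟩ ⟨τ, h1, rfl, -⟩ ⟨x', y'⟩ ⟨τ', h2, rfl, -⟩
    rw [linear_eq_of_travelDir hdir, linear_eq_of_travelDir hdir (playVec n τ', y'),
      h1.linear_playVec, h2.linear_playVec]
    exact weight_const hn heven hk1 hk2 htj (playCoeff_self g) H h1 h2

end Facet

/-- the lifted home-away inequalities are facet-defining. -/
theorem lifted_home_away_facet (n : ℕ) (hn : 4 ≤ n) (heven : Even n)
    (k : ℕ) (hk1 : 1 ≤ k) (hk2 : k ≤ 2 * n - 2) (hk3 : k ≠ 2 * n - 2)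
    (t j : ℕ) (ht1 : 1 ≤ t) (htn : t ≤ n) (hj1 : 1 ≤ j) (hjn : j ≤ n) (htj : t ≠ j) :
    IsFacetLE (fun z : Pt n =>
      xval z 1 j t + xval z k j t + (∑ i ∈ Finset.Icc 1 n \ {t}, xval z k t i)
        + xval z (k + 1) j t - yval z t t j) 1 := by
  have hk : k + 1 ≤ 2 * n - 2 := by omega
  have htj' : (⟨t, Finset.mem_Icc.2 ⟨ht1, htn⟩⟩ : Team n) ≠ ⟨j, Finset.mem_Icc.2 ⟨hj1, hjn⟩⟩ :=
    fun h => htj (congrArg Subtype.val h)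
  have h1 := fun z (hz : z ∈ Ptt n) => liftedForm_le htj' hk1 hk hz
  have h2 := adim_face_add_one hn heven htj' hk1 hk
  simp only [liftedForm, IsLinearMap.mk'_apply] at h1 h2
  exact ⟨h1, h2⟩

end TTP
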